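/- Let F be a perfectoid field with respect to the prime p, and let E be a field equipped with a multiplicative nonarchimedean norm under which E is complete, together with an isometric ring homomorphism F → E making E a finite-dimensional F-vector space. Let 𝔬_F = {x ∈ F : ‖x‖ ≤ 1} and 𝔬_E = {x ∈ E : ‖x‖ ≤ 1}, and regard 𝔬_E as an 𝔬_F-algebra via the embedding (which maps 𝔬_F into 𝔬_E since it is isometric). Then the module of Kähler differentials Ω_{𝔬_E/𝔬_F} is zero. (In other words, any perfectoid field is deeply ramified.) -/

import Mathlib

/-- A multiplicative nonarchimedean norm on a field `F`, with respect to which `F` is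
complete (every Cauchy sequence converges). -/
structure CompleteMulNorm (F : Type*) [Field F] where
  nrm : F → ℝ
  nonneg : ∀ x, 0 ≤ nrm x
  eq_zero_iff : ∀ x, nrm x = 0 ↔ x = 0
  mul : ∀ x y, nrm (x * y) = nrm x * nrm y
  nonarch : ∀ x y, nrm (x + y) ≤ max (nrm x) (nrm y)
  complete : ∀ u : ℕ → F,
    (∀ ε : ℝ, 0 < ε → ∃ N : ℕ, ∀ m ≥ N, ∀ n ≥ N, nrm (u m - u n) < ε) →
    ∃ x : F, ∀ ε : ℝ, 0 < ε → ∃ N : ℕ, ∀ n ≥ N, nrm (u n - x) < ε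

theorem CompleteMulNorm.nrm_one {F : Type*} [Field F] (ν : CompleteMulNorm F) :
    ν.nrm 1 = 1 := by
  have h := ν.mul 1 1
  rw [one_mul] at h
  have h0 : ν.nrm 1 ≠ 0 := fun hz => one_ne_zero ((ν.eq_zero_iff 1).mp hz)
  have key : ν.nrm 1 * (ν.nrm 1 - 1) = 0 := by linear_combination -h
  rcases mul_eq_zero.mp key with h1 | h1
  · exact absurd h1 h0
  · linarith

theorem CompleteMulNorm.nrm_neg {F : Type*} [Field F] (ν : CompleteMulNorm F) (x : F) :
    ν.nrm (-x) = ν.nrm x := by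
  have hsq : ν.nrm (-1 : F) * ν.nrm (-1 : F) = 1 := by
    rw [← ν.mul, neg_one_mul, neg_neg, ν.nrm_one]
  have h0 := ν.nonneg (-1 : F)
  have h1 : ν.nrm (-1 : F) = 1 := by
    have hle : ν.nrm (-1 : F) ≤ 1 := by nlinarith [sq_nonneg (ν.nrm (-1 : F) - 1)]
    have hge : (1 : ℝ) ≤ ν.nrm (-1 : F) := by nlinarith
    linarith
  calc ν.nrm (-x) = ν.nrm ((-1) * x) := by rw [neg_one_mul]
    _ = ν.nrm x := by rw [ν.mul, h1, one_mul]

/-- The ring of integers `𝔬_F = {x ∈ F : ‖x‖ ≤ 1}` of a multiplicatively normed field. -/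
def CompleteMulNorm.intRing {F : Type*} [Field F] (ν : CompleteMulNorm F) : Subring F where
  carrier := {x | ν.nrm x ≤ 1}
  mul_mem' := by
    intro a b ha hb
    simp only [Set.mem_setOf_eq] at *
    rw [ν.mul]
    nlinarith [ν.nonneg a, ν.nonneg b]
  one_mem' := by
    simp only [Set.mem_setOf_eq, ν.nrm_one, le_refl]
  add_mem' := by
    intro a b ha hb
    simp only [Set.mem_setOf_eq] at *
    exact le_trans (ν.nonarch a b) (max_le ha hb)
  zero_mem' := by
    simp only [Set.mem_setOf_eq]
    rw [(ν.eq_zero_iff 0).mpr rfl]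
    norm_num
  neg_mem' := by
    intro a ha
    simp only [Set.mem_setOf_eq] at *
    rw [ν.nrm_neg]
    exact ha

/-- The field `F`, equipped with a complete multiplicative nonarchimedean norm, is a
perfectoid field with respect to the prime `p`. -/
def CompleteMulNorm.IsPerfectoid {F : Type*} [Field F] (p : ℕ) (ν : CompleteMulNorm F) : Prop :=
  CharZero F ∧
  ν.nrm (p : F) < 1 ∧
  (∀ ε : ℝ, 0 < ε → ∃ x : F, x ≠ 0 ∧ 1 < ν.nrm x ∧ ν.nrm x < 1 + ε) ∧
  ∀ x : F, ν.nrm x ≤ 1 → ∃ y : F, ν.nrm (x - y ^ p) ≤ ν.nrm (p : F)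

open Polynomial
open scoped IntermediateField

section Congruences

theorem norm_mul_le_of_le_one {Ω : Type*} [NormedField Ω] {x y : Ω} {r : ℝ} (hx : ‖x‖ ≤ 1)
    (hy : ‖y‖ ≤ r) : ‖x * y‖ ≤ r := by
  rw [norm_mul]
  exact (mul_le_of_le_one_left (norm_nonneg y) hx).trans hy

theorem norm_pow_le_one_of_le {Ω : Type*} [NormedField Ω] {x : Ω} (hx : ‖x‖ ≤ 1) (n : ℕ) :
    ‖x ^ n‖ ≤ 1 := by
  rw [norm_pow]
  exact pow_le_one₀ (norm_nonneg x) hx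

variable {Ω : Type*} [NormedField Ω] [IsUltrametricDist Ω]

theorem ultrametric_norm_add_le {x y : Ω} {r : ℝ} (hx : ‖x‖ ≤ r) (hy : ‖y‖ ≤ r) : ‖x + y‖ ≤ r :=
  (IsUltrametricDist.norm_add_le_max x y).trans (max_le hx hy)

theorem ultrametric_norm_sub_le {x y : Ω} {r : ℝ} (hx : ‖x‖ ≤ r) (hy : ‖y‖ ≤ r) : ‖x - y‖ ≤ r := by
  rw [sub_eq_add_neg]
  exact ultrametric_norm_add_le hx (by rwa [norm_neg])

theorem ultrametric_norm_sub_le_trans {x y z : Ω} {r : ℝ} (hxy : ‖x - y‖ ≤ r) (hyz : ‖y - z‖ ≤ r) :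
    ‖x - z‖ ≤ r := by
  simpa using ultrametric_norm_add_le hxy hyz

theorem norm_mul_sub_mul_le {a b c d : Ω} {r : ℝ} (hb : ‖b‖ ≤ 1) (hc : ‖c‖ ≤ 1)
    (hac : ‖a - c‖ ≤ r) (hbd : ‖b - d‖ ≤ r) : ‖a * b - c * d‖ ≤ r := by
  have h : a * b - c * d = b * (a - c) + c * (b - d) := by ring
  rw [h]
  exact ultrametric_norm_add_le (norm_mul_le_of_le_one hb hac) (norm_mul_le_of_le_one hc hbd)

theorem norm_pow_sub_pow_le {a b : Ω} (ha : ‖a‖ ≤ 1) (hb : ‖b‖ ≤ 1) (n : ℕ) :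
    ‖a ^ n - b ^ n‖ ≤ ‖a - b‖ := by
  induction n with
  | zero => simp
  | succ n ih =>
    rw [pow_succ, pow_succ]
    exact norm_mul_sub_mul_le ha (norm_pow_le_one_of_le hb n) ih le_rfl

variable (Ω) in
/-- The closed unit ball of an ultrametric normed field. -/
def unitBall : Subring Ω where
  carrier := {x | ‖x‖ ≤ 1}
  mul_mem' ha hb := norm_mul_le_of_le_one ha hb
  one_mem' := norm_one.le
  add_mem' ha hb := ultrametric_norm_add_le ha hb
  zero_mem' := by simp
  neg_mem' := by simp

@[simp] theorem mem_unitBall {x : Ω} : x ∈ unitBall Ω ↔ ‖x‖ ≤ 1 := Iff.rfl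

theorem norm_add_pow_prime_sub_le {p : ℕ} (hp : p.Prime) {a b : Ω} (ha : ‖a‖ ≤ 1)
    (hb : ‖b‖ ≤ 1) : ‖(a + b) ^ p - (a ^ p + b ^ p)‖ ≤ ‖(p : Ω)‖ := by
  obtain ⟨r, hr⟩ := exists_add_pow_prime_eq hp (⟨a, ha⟩ : unitBall Ω) ⟨b, hb⟩
  have h := congrArg Subtype.val hr
  simp only [Subring.coe_pow, Subring.coe_add, Subring.coe_mul, Subring.coe_natCast] at h
  have h' : (a + b) ^ p - (a ^ p + b ^ p) = (a * b * r) * (p : Ω) := by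
    rw [h]; ring
  rw [h']
  exact norm_mul_le_of_le_one
    (norm_mul_le_of_le_one (norm_mul_le_of_le_one ha hb) r.2) le_rfl

theorem norm_sum_pow_prime_sub_le {p : ℕ} (hp : p.Prime) {ι : Type*} (s : Finset ι) (f : ι → Ω)
    (hf : ∀ i ∈ s, ‖f i‖ ≤ 1) : ‖(∑ i ∈ s, f i) ^ p - ∑ i ∈ s, f i ^ p‖ ≤ ‖(p : Ω)‖ := by
  classical
  induction s using Finset.induction_on with
  | empty => simp [hp.ne_zero]
  | insert i s hi ih =>
    rw [Finset.sum_insert hi, Finset.sum_insert hi]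
    have hs : ‖∑ j ∈ s, f j‖ ≤ 1 := IsUltrametricDist.norm_sum_le_of_forall_le_of_nonneg
      zero_le_one fun j hj => hf j (Finset.mem_insert_of_mem hj)
    refine ultrametric_norm_sub_le_trans
      (norm_add_pow_prime_sub_le hp (hf i (Finset.mem_insert_self i s)) hs) ?_
    rw [add_sub_add_left_eq_sub]
    exact ih fun j hj => hf j (Finset.mem_insert_of_mem hj)

theorem norm_sum_pow_prime_pow_sub_le {p : ℕ} (hp : p.Prime) {ι : Type*} (s : Finset ι)
    (f : ι → Ω) (hf : ∀ i ∈ s, ‖f i‖ ≤ 1) (n : ℕ) :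
    ‖(∑ i ∈ s, f i) ^ p ^ n - ∑ i ∈ s, f i ^ p ^ n‖ ≤ ‖(p : Ω)‖ := by
  induction n with
  | zero => simp
  | succ n ih =>
    have hs : ‖∑ j ∈ s, f j‖ ≤ 1 := IsUltrametricDist.norm_sum_le_of_forall_le_of_nonneg
      zero_le_one hf
    have hs' : ‖∑ j ∈ s, f j ^ p ^ n‖ ≤ 1 := IsUltrametricDist.norm_sum_le_of_forall_le_of_nonneg
      zero_le_one fun i hi => norm_pow_le_one_of_le (hf i hi) _
    simp only [pow_succ p n, pow_mul]
    exact ultrametric_norm_sub_le_trans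
      ((norm_pow_sub_pow_le (norm_pow_le_one_of_le hs _) hs' p).trans ih)
      (norm_sum_pow_prime_sub_le hp s _ fun i hi => norm_pow_le_one_of_le (hf i hi) _)

theorem norm_pow_sub_pow_le_max {p : ℕ} (hp : p.Prime) {a b : Ω} (ha : ‖a‖ ≤ 1)
    (hb : ‖b‖ ≤ 1) (n : ℕ) :
    ‖a ^ p ^ n - b ^ p ^ n‖ ≤ max (‖a - b‖ ^ p ^ n) ‖(p : Ω)‖ := by
  have h := norm_sum_pow_prime_pow_sub_le hp (Finset.univ : Finset (Fin 2)) ![a - b, b]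
    (by simpa [Fin.forall_fin_two, hb] using ultrametric_norm_sub_le ha hb) n
  simp only [Fin.sum_univ_two, Matrix.cons_val_zero, Matrix.cons_val_one, sub_add_cancel] at h
  have h' : a ^ p ^ n - b ^ p ^ n =
      (a ^ p ^ n - ((a - b) ^ p ^ n + b ^ p ^ n)) + (a - b) ^ p ^ n := by ring
  rw [h', add_comm, ← norm_pow]
  exact ultrametric_norm_add_le (le_max_left _ _) (h.trans (le_max_right _ _))

theorem norm_pow_prime_pow_sub_le {p : ℕ} (hp : p.Prime) {a b : Ω} (ha : ‖a‖ ≤ 1)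
    (hb : ‖b‖ ≤ 1) (n : ℕ) :
    ‖(a - b) ^ p ^ n‖ ≤ max ‖a ^ p ^ n - b ^ p ^ n‖ ‖(p : Ω)‖ := by
  have h := norm_sum_pow_prime_pow_sub_le hp (Finset.univ : Finset (Fin 2)) ![a - b, b]
    (by simpa [Fin.forall_fin_two, hb] using ultrametric_norm_sub_le ha hb) n
  simp only [Fin.sum_univ_two, Matrix.cons_val_zero, Matrix.cons_val_one, sub_add_cancel] at h
  have h' : (a - b) ^ p ^ n = (a ^ p ^ n - b ^ p ^ n) -
      (a ^ p ^ n - ((a - b) ^ p ^ n + b ^ p ^ n)) := by ring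
  rw [h']
  exact ultrametric_norm_sub_le (le_max_left _ _) (h.trans (le_max_right _ _))

end Congruences

section IntegralPolynomials

/-- A polynomial over `K` all of whose coefficients have norm at most one in `Ω`. -/
def IsIntegralPoly (Ω : Type*) [NormedField Ω] {K : Type*} [Field K] [Algebra K Ω]
    (P : K[X]) : Prop :=
  ∀ i, ‖algebraMap K Ω (P.coeff i)‖ ≤ 1

theorem IsIntegralPoly.map {Ω : Type*} [NormedField Ω] {K : Type*} [Field K] [Algebra K Ω]
    {P : K[X]} (hP : IsIntegralPoly Ω P) : IsIntegralPoly Ω (P.map (algebraMap K Ω)) := by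
  intro i
  simpa using hP i

theorem IsIntegralPoly.C_mul_X {Ω : Type*} [NormedField Ω] {K : Type*} [Field K] [Algebra K Ω]
    {t : K} (ht : ‖algebraMap K Ω t‖ ≤ 1) : IsIntegralPoly Ω (C t * X) := by
  intro i
  rw [coeff_C_mul, coeff_X]
  split_ifs <;> simp [ht]

variable {Ω : Type*} [NormedField Ω] [IsUltrametricDist Ω]
  {K : Type*} [Field K] [Algebra K Ω]

variable (Ω K) in
/-- The elements of `K` whose image in `Ω` has norm at most one. -/
def integerSubring : Subring K := (unitBall Ω).comap (algebraMap K Ω)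

theorem mem_integerSubring {a : K} : a ∈ integerSubring Ω K ↔ ‖algebraMap K Ω a‖ ≤ 1 := Iff.rfl

theorem isIntegralPoly_iff {P : K[X]} :
    IsIntegralPoly Ω P ↔ P ∈ lifts (integerSubring Ω K).subtype := by
  rw [lifts_iff_coeff_lifts]
  simp [IsIntegralPoly, mem_integerSubring]

namespace IsIntegralPoly

theorem mul {P Q : K[X]} (hP : IsIntegralPoly Ω P) (hQ : IsIntegralPoly Ω Q) :
    IsIntegralPoly Ω (P * Q) := by
  rw [isIntegralPoly_iff] at *
  exact mul_mem hP hQ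

theorem add {P Q : K[X]} (hP : IsIntegralPoly Ω P) (hQ : IsIntegralPoly Ω Q) :
    IsIntegralPoly Ω (P + Q) := by
  rw [isIntegralPoly_iff] at *
  exact add_mem hP hQ

theorem pow {P : K[X]} (hP : IsIntegralPoly Ω P) (n : ℕ) : IsIntegralPoly Ω (P ^ n) := by
  rw [isIntegralPoly_iff] at *
  exact pow_mem hP n

theorem derivative {P : K[X]} (hP : IsIntegralPoly Ω P) : IsIntegralPoly Ω P.derivative := by
  intro i
  rw [coeff_derivative, map_mul]
  refine norm_mul_le_of_le_one (hP _) ?_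
  have h := IsUltrametricDist.norm_natCast_le_one Ω (i + 1)
  simpa using h

theorem norm_aeval_le_one {P : K[X]} (hP : IsIntegralPoly Ω P) {x : Ω} (hx : ‖x‖ ≤ 1) :
    ‖aeval x P‖ ≤ 1 := by
  rw [aeval_eq_sum_range]
  refine IsUltrametricDist.norm_sum_le_of_forall_le_of_nonneg zero_le_one fun i _ => ?_
  rw [Algebra.smul_def]
  exact norm_mul_le_of_le_one (hP i) (norm_pow_le_one_of_le hx i)

theorem norm_aeval_sub_aeval_le {P : K[X]} (hP : IsIntegralPoly Ω P) {x y : Ω} (hx : ‖x‖ ≤ 1)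
    (hy : ‖y‖ ≤ 1) : ‖aeval x P - aeval y P‖ ≤ ‖x - y‖ := by
  rw [aeval_eq_sum_range, aeval_eq_sum_range, ← Finset.sum_sub_distrib]
  refine IsUltrametricDist.norm_sum_le_of_forall_le_of_nonneg (norm_nonneg _) fun i _ => ?_
  rw [← smul_sub, Algebra.smul_def]
  exact norm_mul_le_of_le_one (hP i) (norm_pow_sub_pow_le hx hy i)

/-- Roots of a monic polynomial with integral coefficients are integral. -/
theorem norm_le_one_of_root {P : K[X]} (hP : IsIntegralPoly Ω P) (hm : P.Monic) {z : Ω}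
    (hz : aeval z P = 0) : ‖z‖ ≤ 1 := by
  by_contra! h
  have h0 : P.natDegree ≠ 0 := by
    intro h0
    rw [hm.natDegree_eq_zero.mp h0] at hz
    simp at hz
  rw [aeval_eq_sum_range, Finset.sum_range_succ, coeff_natDegree, hm.leadingCoeff, one_smul] at hz
  have h1 : ‖∑ i ∈ Finset.range P.natDegree, P.coeff i • z ^ i‖ ≤ ‖z‖ ^ (P.natDegree - 1) := by
    refine IsUltrametricDist.norm_sum_le_of_forall_le_of_nonneg (by positivity) fun i hi => ?_
    rw [Algebra.smul_def]
    refine norm_mul_le_of_le_one (hP i) ?_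
    rw [norm_pow]
    exact pow_le_pow_right₀ h.le (by have := Finset.mem_range.mp hi; omega)
  rw [eq_neg_of_add_eq_zero_left hz, norm_neg, norm_pow] at h1
  exact absurd h1 (not_le.mpr (pow_lt_pow_right₀ h (by omega)))

end IsIntegralPoly

/-- If all roots of a monic polynomial over an algebraically closed field are integral, then so are
its coefficients. -/
theorem isIntegralPoly_of_roots [IsAlgClosed Ω] {P : K[X]} (hm : P.Monic)
    (h : ∀ z : Ω, aeval z P = 0 → ‖z‖ ≤ 1) : IsIntegralPoly Ω P := by
  have hs := (IsAlgClosed.splits (P.map (algebraMap K Ω))).eq_prod_roots_of_monic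
    (hm.map (algebraMap K Ω))
  have key : IsIntegralPoly Ω (P.map (algebraMap K Ω)) := by
    rw [isIntegralPoly_iff, hs]
    refine multiset_prod_mem _ fun q hq => ?_
    obtain ⟨r, hr, rfl⟩ := Multiset.mem_map.mp hq
    have hr1 : ‖r‖ ≤ 1 := h r (by
      rw [← eval_map_algebraMap]
      exact (mem_roots'.mp hr).2)
    rw [← isIntegralPoly_iff]
    intro i
    have hX : ‖(X : Polynomial Ω).coeff i‖ ≤ 1 := by
      rw [coeff_X]
      split_ifs <;> simp
    have hC : ‖(C r : Polynomial Ω).coeff i‖ ≤ 1 := by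
      rw [coeff_C]
      split_ifs <;> simp [hr1]
    rw [coeff_sub]
    exact ultrametric_norm_sub_le hX hC
  intro i
  simpa using key i

theorem pow_card_le_prod_map {ι : Type*} (f : ι → ℝ) {a : ℝ} (ha : 0 ≤ a) (s : Multiset ι)
    (h : ∀ i ∈ s, a ≤ f i) : a ^ Multiset.card s ≤ (s.map f).prod := by
  induction s using Multiset.induction_on with
  | empty => simp
  | cons i s ih =>
    rw [Multiset.card_cons, Multiset.map_cons, Multiset.prod_cons, pow_succ']
    have hi := h i (Multiset.mem_cons_self i s)
    exact mul_le_mul hi (ih fun j hj => h j (Multiset.mem_cons_of_mem hj)) (by positivity)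
      (ha.trans hi)

/-- A monic polynomial that is small at `ξ` has a root close to `ξ`. -/
theorem exists_root_norm_sub_pow_le [IsAlgClosed Ω] {P : K[X]} (hm : P.Monic)
    (hd : P.natDegree ≠ 0) (ξ : Ω) : ∃ z : Ω, aeval z P = 0 ∧
      ‖ξ - z‖ ^ P.natDegree ≤ ‖aeval ξ P‖ := by
  classical
  have hspl := IsAlgClosed.splits (P.map (algebraMap K Ω))
  have hcard : Multiset.card (P.map (algebraMap K Ω)).roots = P.natDegree := by
    rw [← hspl.natDegree_eq_card_roots, natDegree_map]
  have hne : (P.map (algebraMap K Ω)).roots.toFinset.Nonempty := by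
    rw [Multiset.toFinset_nonempty, ← Multiset.card_pos, hcard]
    omega
  obtain ⟨z, hz, hmin⟩ := Finset.exists_min_image _ (fun r => ‖ξ - r‖) hne
  rw [Multiset.mem_toFinset] at hz
  refine ⟨z, by rw [← eval_map_algebraMap]; exact (mem_roots'.mp hz).2, ?_⟩
  have h1 : ‖aeval ξ P‖ = ((P.map (algebraMap K Ω)).roots.map fun r => ‖ξ - r‖).prod := by
    rw [← eval_map_algebraMap, hspl.eval_eq_prod_roots_of_monic (hm.map _)]
    exact (map_multiset_prod (normHom (α := Ω)) _).trans (by rw [Multiset.map_map]; rfl)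
  rw [h1, ← hcard]
  exact pow_card_le_prod_map _ (norm_nonneg _) _ fun r hr =>
    hmin r (Multiset.mem_toFinset.mpr hr)

end IntegralPolynomials

section FrobeniusLifting

variable {Ω : Type*} [NormedField Ω] [IsUltrametricDist Ω]
  {K : Type*} [Field K] [Algebra K Ω] {p : ℕ}

/-- If the coefficients of `B` are `p ^ n`-th roots modulo `p` of those of `A`, then
`B(ξ) ^ (p ^ n)` is congruent to `A(ξ ^ (p ^ n))` modulo `p`. -/
theorem norm_aeval_pow_sub_aeval_le (hp : p.Prime) {A B : K[X]} {n : ℕ}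
    (hB : IsIntegralPoly Ω B)
    (h : ∀ i, ‖algebraMap K Ω (A.coeff i - B.coeff i ^ p ^ n)‖ ≤ ‖(p : Ω)‖) {ξ : Ω}
    (hξ : ‖ξ‖ ≤ 1) : ‖aeval ξ B ^ p ^ n - aeval (ξ ^ p ^ n) A‖ ≤ ‖(p : Ω)‖ := by
  set N := max A.natDegree B.natDegree + 1
  have hA' : A.natDegree < N := by omega
  have hB' : B.natDegree < N := by omega
  rw [aeval_eq_sum_range' hA', aeval_eq_sum_range' hB']
  refine ultrametric_norm_sub_le_trans (norm_sum_pow_prime_pow_sub_le hp _ _ (fun i _ => ?_) n) ?_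
  · rw [Algebra.smul_def]
    exact norm_mul_le_of_le_one (hB i) (norm_pow_le_one_of_le hξ i)
  · rw [← Finset.sum_sub_distrib]
    refine IsUltrametricDist.norm_sum_le_of_forall_le_of_nonneg (norm_nonneg _) fun i _ => ?_
    rw [norm_sub_rev]
    have e : A.coeff i • (ξ ^ p ^ n) ^ i - (B.coeff i • ξ ^ i) ^ p ^ n =
        (ξ ^ i) ^ p ^ n * algebraMap K Ω (A.coeff i - B.coeff i ^ p ^ n) := by
      rw [Algebra.smul_def, Algebra.smul_def, map_sub, map_pow]
      ring
    rw [e]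
    exact norm_mul_le_of_le_one (norm_pow_le_one_of_le (norm_pow_le_one_of_le hξ _) _) (h i)

theorem norm_natCast_pow_sub_le (hp : p.Prime) (m : ℕ) :
    ‖(m : Ω) ^ p - m‖ ≤ ‖(p : Ω)‖ := by
  simpa using norm_sum_pow_prime_sub_le hp (Finset.range m) (fun _ => (1 : Ω)) (by simp)

theorem norm_derivative_coeff_sub_pow_le (hp : p.Prime) {A B : K[X]}
    (hB : IsIntegralPoly Ω B)
    (h : ∀ i, ‖algebraMap K Ω (A.coeff i - B.coeff i ^ p)‖ ≤ ‖(p : Ω)‖) (i : ℕ) :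
    ‖algebraMap K Ω (A.derivative.coeff i - B.derivative.coeff i ^ p)‖ ≤ ‖(p : Ω)‖ := by
  have hi := h (i + 1)
  have hm := norm_natCast_pow_sub_le (Ω := Ω) hp (i + 1)
  have e : algebraMap K Ω (A.derivative.coeff i - B.derivative.coeff i ^ p) =
      ((i + 1 : ℕ) : Ω) * algebraMap K Ω (A.coeff (i + 1) - B.coeff (i + 1) ^ p) -
      algebraMap K Ω (B.coeff (i + 1)) ^ p * (((i + 1 : ℕ) : Ω) ^ p - (i + 1 : ℕ)) := by
    simp only [coeff_derivative, mul_pow, map_sub, map_mul, map_pow, map_add, map_natCast, map_one,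
      Nat.cast_add, Nat.cast_one]
    ring
  rw [e]
  exact ultrametric_norm_sub_le
    (norm_mul_le_of_le_one (IsUltrametricDist.norm_natCast_le_one Ω _) hi)
    (norm_mul_le_of_le_one (norm_pow_le_one_of_le (hB _) p) hm)

variable (Ω K p) in
/-- Every integral element of `K` is a `p`-th power modulo `p`. -/
def IsFrobeniusSurjective : Prop :=
  ∀ a : K, ‖algebraMap K Ω a‖ ≤ 1 → ∃ b : K, ‖algebraMap K Ω (a - b ^ p)‖ ≤ ‖(p : Ω)‖

theorem norm_le_one_of_norm_sub_pow_le {a b : Ω} {n : ℕ} (hn : n ≠ 0) (ha : ‖a‖ ≤ 1)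
    (h : ‖a - b ^ n‖ ≤ 1) : ‖b‖ ≤ 1 := by
  have h1 : ‖b ^ n‖ ≤ 1 := by simpa using ultrametric_norm_sub_le ha h
  rwa [norm_pow, pow_le_one_iff_of_nonneg (norm_nonneg b) hn] at h1

theorem IsFrobeniusSurjective.exists_pow_prime_pow (h : IsFrobeniusSurjective Ω K p)
    (hp : p.Prime) (n : ℕ) (a : K) (ha : ‖algebraMap K Ω a‖ ≤ 1) :
    ∃ b : K, ‖algebraMap K Ω b‖ ≤ 1 ∧
      ‖algebraMap K Ω (a - b ^ p ^ n)‖ ≤ ‖(p : Ω)‖ := by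
  induction n generalizing a with
  | zero => exact ⟨a, ha, by simp⟩
  | succ n ih =>
    obtain ⟨b, hb1, hb⟩ := ih a ha
    obtain ⟨c, hc⟩ := h b hb1
    rw [map_sub, map_pow] at hc hb
    have hc1 : ‖algebraMap K Ω c‖ ≤ 1 := norm_le_one_of_norm_sub_pow_le hp.ne_zero hb1
      (hc.trans (IsUltrametricDist.norm_natCast_le_one Ω p))
    refine ⟨c, hc1, ?_⟩
    rw [map_sub, map_pow, pow_succ', pow_mul]
    exact ultrametric_norm_sub_le_trans hb
      ((norm_pow_sub_pow_le hb1 (norm_pow_le_one_of_le hc1 p) _).trans hc)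

theorem IsFrobeniusSurjective.exists_poly (h : IsFrobeniusSurjective Ω K p) (hp : p.Prime)
    (n : ℕ) {P : K[X]} (hm : P.Monic) (hP : IsIntegralPoly Ω P) :
    ∃ Q : K[X], Q.Monic ∧ Q.natDegree = P.natDegree ∧ IsIntegralPoly Ω Q ∧
      ∀ i, ‖algebraMap K Ω (P.coeff i - Q.coeff i ^ p ^ n)‖ ≤ ‖(p : Ω)‖ := by
  classical
  have hβ : ∀ i, ∃ b : K, (P.coeff i = 0 → b = 0) ∧ (P.coeff i = 1 → b = 1) ∧
      ‖algebraMap K Ω b‖ ≤ 1 ∧ ‖algebraMap K Ω (P.coeff i - b ^ p ^ n)‖ ≤ ‖(p : Ω)‖ := by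
    intro i
    by_cases h0 : P.coeff i = 0
    · exact ⟨0, by simp, by simp [h0], by simp, by simp [h0, hp.ne_zero]⟩
    by_cases h1 : P.coeff i = 1
    · exact ⟨1, by simp [h1], by simp, by simp, by simp [h1]⟩
    obtain ⟨b, hb⟩ := h.exists_pow_prime_pow hp n _ (hP i)
    exact ⟨b, fun h => absurd h h0, fun h => absurd h h1, hb⟩
  choose β hβ0 hβ1 hβi hβp using hβ
  set Q : K[X] := ∑ i ∈ Finset.range (P.natDegree + 1), monomial i (β i) with hQ
  have hc : ∀ i, Q.coeff i = β i := by
    intro i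
    rw [hQ, finsetSum_coeff]
    simp only [coeff_monomial]
    rw [Finset.sum_ite_eq']
    split_ifs with hi
    · rfl
    · exact (hβ0 i (coeff_eq_zero_of_natDegree_lt (by simpa using hi))).symm
  have hdeg : Q.natDegree ≤ P.natDegree := natDegree_le_iff_coeff_eq_zero.mpr fun i hi => by
    rw [hc, hβ0 i (coeff_eq_zero_of_natDegree_lt hi)]
  have hlead : Q.coeff P.natDegree = 1 := by
    rw [hc, hβ1 _ hm.coeff_natDegree]
  refine ⟨Q, monic_of_natDegree_le_of_coeff_eq_one _ hdeg hlead,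
    le_antisymm hdeg (le_natDegree_of_ne_zero (by simp [hlead])), fun i => ?_, fun i => ?_⟩
  · rw [hc]; exact hβi i
  · rw [hc]; exact hβp i

/-- If `B` is a `p ^ n`-th root of `A` modulo `p` in the sense of coefficients, then every root
of `A` is close to the `p ^ n`-th power of a root of `B`. -/
theorem exists_root_pow_close [IsAlgClosed Ω] (hp : p.Prime) {A B : K[X]} {n : ℕ}
    (hBm : B.Monic) (hd : B.natDegree ≠ 0) (hB : IsIntegralPoly Ω B)
    (h : ∀ i, ‖algebraMap K Ω (A.coeff i - B.coeff i ^ p ^ n)‖ ≤ ‖(p : Ω)‖) {x : Ω}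
    (hx1 : ‖x‖ ≤ 1) (hx : aeval x A = 0) :
    ∃ z : Ω, aeval z B = 0 ∧ ‖x - z ^ p ^ n‖ ^ B.natDegree ≤ ‖(p : Ω)‖ := by
  have hq : 0 < p ^ n := pow_pos hp.pos n
  obtain ⟨ξ, rfl⟩ := IsAlgClosed.exists_pow_nat_eq x hq
  have hξ : ‖ξ‖ ≤ 1 := by
    rwa [norm_pow, pow_le_one_iff_of_nonneg (norm_nonneg ξ) hq.ne'] at hx1
  obtain ⟨z, hz, hzξ⟩ := exists_root_norm_sub_pow_le hBm hd ξ
  refine ⟨z, hz, ?_⟩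
  have h1 := norm_aeval_pow_sub_aeval_le hp hB h hξ
  rw [hx, sub_zero, norm_pow] at h1
  have hz1 := hB.norm_le_one_of_root hBm hz
  have hp1 : ‖(p : Ω)‖ ≤ 1 := IsUltrametricDist.norm_natCast_le_one Ω p
  rcases le_max_iff.mp (norm_pow_sub_pow_le_max hp hξ hz1 n) with h2 | h2
  · calc ‖ξ ^ p ^ n - z ^ p ^ n‖ ^ B.natDegree ≤ (‖ξ - z‖ ^ p ^ n) ^ B.natDegree := by gcongr
      _ = (‖ξ - z‖ ^ B.natDegree) ^ p ^ n := by rw [← pow_mul, ← pow_mul, mul_comm]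
      _ ≤ ‖aeval ξ B‖ ^ p ^ n := by gcongr
      _ ≤ _ := h1
  · exact (pow_le_pow_left₀ (norm_nonneg _) h2 _).trans
      (pow_le_of_le_one (norm_nonneg _) hp1 hd)

end FrobeniusLifting

section MonicRoots

variable {Ω : Type*} [NormedField Ω] [IsUltrametricDist Ω] [IsAlgClosed Ω]
  {K : Type*} [Field K] [Algebra K Ω]

theorem IsIntegralPoly.of_dvd {P Q : K[X]} (hP : IsIntegralPoly Ω P) (hm : P.Monic)
    (hQ : Q.Monic) (h : Q ∣ P) : IsIntegralPoly Ω Q :=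
  isIntegralPoly_of_roots hQ fun _ hz =>
    hP.norm_le_one_of_root hm (aeval_eq_zero_of_dvd_aeval_eq_zero h hz)

theorem norm_aeval_derivative_le_of_dvd {P Q : K[X]} (hP : IsIntegralPoly Ω P) (hm : P.Monic)
    (hQ : Q.Monic) (h : Q ∣ P) {z : Ω} (hz : aeval z Q = 0) :
    ‖aeval z P.derivative‖ ≤ ‖aeval z Q.derivative‖ := by
  obtain ⟨S, rfl⟩ := h
  have hS : IsIntegralPoly Ω S := hP.of_dvd hm (hQ.of_mul_monic_left hm) (Dvd.intro_left _ rfl)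
  have hz1 : ‖z‖ ≤ 1 := hP.norm_le_one_of_root hm (by simp [hz])
  rw [derivative_mul, map_add, map_mul, map_mul, hz, zero_mul, add_zero, mul_comm]
  exact norm_mul_le_of_le_one (hS.norm_aeval_le_one hz1) le_rfl

/-- The derivative of a monic integral polynomial at a root is bounded by the distance to any other
root. -/
theorem norm_aeval_derivative_le_of_roots {P : K[X]} (hP : IsIntegralPoly Ω P) (hm : P.Monic)
    {z w : Ω} (hz : aeval z P = 0) (hw : aeval w P = 0) (hne : z ≠ w) :
    ‖aeval z P.derivative‖ ≤ ‖z - w‖ := by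
  obtain ⟨S, hS⟩ : X - C z ∣ P.map (algebraMap K Ω) := by
    rw [dvd_iff_isRoot, IsRoot.def, eval_map_algebraMap, hz]
  have hPm := hm.map (algebraMap K Ω)
  have hSm : S.Monic := (monic_X_sub_C z).of_mul_monic_left (hS ▸ hPm)
  have hSi : IsIntegralPoly Ω S := hP.map.of_dvd hPm hSm (Dvd.intro_left _ hS.symm)
  have hSw : aeval w S = 0 := by
    have h : eval w (P.map (algebraMap K Ω)) = 0 := by rw [eval_map_algebraMap, hw]
    rw [hS, eval_mul, eval_sub, eval_X, eval_C, mul_eq_zero, sub_eq_zero] at h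
    rw [coe_aeval_eq_eval]
    exact h.resolve_left fun h' => hne h'.symm
  have hSz : aeval z P.derivative = aeval z S := by
    rw [← eval_map_algebraMap, ← derivative_map, hS, derivative_mul]
    simp [coe_aeval_eq_eval]
  have h := hSi.norm_aeval_sub_aeval_le (hP.norm_le_one_of_root hm hz)
    (hP.norm_le_one_of_root hm hw)
  rwa [hSw, sub_zero, ← hSz] at h

end MonicRoots

section Galois

variable {Ω : Type*} [NormedField Ω] {K : Type*} [Field K] [Algebra K Ω]

variable (Ω K) in
/-- The norm on `Ω` is invariant under the automorphisms over `K`. -/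
def IsGaloisInvariantNorm : Prop := ∀ (σ : Ω ≃ₐ[K] Ω) (x : Ω), ‖σ x‖ = ‖x‖

theorem IsGaloisInvariantNorm.intermediateField (h : IsGaloisInvariantNorm Ω K)
    (L : IntermediateField K Ω) : IsGaloisInvariantNorm Ω L :=
  fun σ x => h (σ.restrictScalars K) x

theorem IsGaloisInvariantNorm.norm_eq_of_aeval_minpoly [Normal K Ω]
    (h : IsGaloisInvariantNorm Ω K) {x y : Ω} (hxy : aeval y (minpoly K x) = 0) :
    ‖y‖ = ‖x‖ := by
  obtain ⟨σ, rfl⟩ := minpoly.exists_algEquiv_of_root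
    ((Normal.isIntegral inferInstance x).isAlgebraic) hxy
  exact (h σ y).symm

theorem isGalois_of_isAlgClosed (K Ω : Type*) [Field K] [Field Ω] [Algebra K Ω]
    [Algebra.IsAlgebraic K Ω] [IsAlgClosed Ω] [CharZero K] : IsGalois K Ω := by
  have : IsAlgClosure K Ω := ⟨inferInstance, inferInstance⟩
  infer_instance

variable [IsUltrametricDist Ω] [IsAlgClosed Ω] [Algebra.IsAlgebraic K Ω] [CharZero K]

theorem IsGaloisInvariantNorm.isIntegralPoly_minpoly (h : IsGaloisInvariantNorm Ω K) {x : Ω}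
    (hx : ‖x‖ ≤ 1) : IsIntegralPoly Ω (minpoly K x) := by
  have := isGalois_of_isAlgClosed K Ω
  exact isIntegralPoly_of_roots (minpoly.monic (Algebra.IsIntegral.isIntegral x)) fun z hz =>
    (h.norm_eq_of_aeval_minpoly hz).trans_le hx

theorem norm_coe_algHom_eq (h : IsGaloisInvariantNorm Ω K) {L : IntermediateField K Ω}
    (σ : L →ₐ[K] Ω) (a : L) : ‖σ a‖ = ‖(a : Ω)‖ := by
  have := isGalois_of_isAlgClosed K Ω
  refine h.norm_eq_of_aeval_minpoly ?_
  have h1 : minpoly K (a : Ω) = minpoly K a := minpoly.algebraMap_eq (algebraMap L Ω).injective a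
  rw [h1, aeval_algHom_apply, minpoly.aeval, map_zero]

theorem norm_trace_le (h : IsGaloisInvariantNorm Ω K) {L : IntermediateField K Ω}
    [FiniteDimensional K L] {r : ℝ} {a : L} (ha : ‖(a : Ω)‖ ≤ r) :
    ‖algebraMap K Ω (Algebra.trace K L a)‖ ≤ r := by
  have := isGalois_of_isAlgClosed K Ω
  rw [trace_eq_sum_embeddings Ω]
  exact IsUltrametricDist.norm_sum_le_of_forall_le_of_nonneg ((norm_nonneg _).trans ha)
    fun σ _ => (norm_coe_algHom_eq h σ a).trans_le ha

/-- The trace commutes with `p`-th powers modulo `p` on integral elements. -/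
theorem norm_trace_pow_sub_le {p : ℕ} (hp : p.Prime) (h : IsGaloisInvariantNorm Ω K)
    {L : IntermediateField K Ω} [FiniteDimensional K L] {a : L} (ha : ‖(a : Ω)‖ ≤ 1) :
    ‖algebraMap K Ω (Algebra.trace K L a ^ p - Algebra.trace K L (a ^ p))‖ ≤ ‖(p : Ω)‖ := by
  have := isGalois_of_isAlgClosed K Ω
  rw [map_sub, map_pow, trace_eq_sum_embeddings Ω, trace_eq_sum_embeddings Ω]
  simp only [map_pow]
  exact norm_sum_pow_prime_sub_le hp _ _ fun σ _ => (norm_coe_algHom_eq h σ a).trans_le ha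

/-- Multiplication by `f'(z)`, for `f` the minimal polynomial of `z`, maps the integral elements of
`K(z)` to integral polynomials in `z`. -/
theorem exists_aeval_eq_derivative_minpoly_mul (h : IsGaloisInvariantNorm Ω K) {z : Ω}
    (hz : ‖z‖ ≤ 1) {a : Ω} (haz : a ∈ K⟮z⟯) (ha : ‖a‖ ≤ 1) :
    ∃ g : K[X], IsIntegralPoly Ω g ∧ aeval z g = aeval z (minpoly K z).derivative * a := by
  have := isGalois_of_isAlgClosed K Ω
  have hzi : IsIntegral K z := Algebra.IsIntegral.isIntegral z
  have : FiniteDimensional K K⟮z⟯ := IntermediateField.adjoin.finiteDimensional hzi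
  let pb := IntermediateField.adjoin.powerBasis hzi
  have hgen : (pb.gen : Ω) = z := by
    simp [pb, IntermediateField.adjoin.powerBasis_gen]
  have hmin : minpoly K pb.gen = minpoly K z := by
    rw [← minpoly.algebraMap_eq (algebraMap K⟮z⟯ Ω).injective pb.gen]
    exact congrArg _ hgen
  have hgi : IsIntegral K pb.gen := Algebra.IsIntegral.isIntegral _
  have hdiv : IsIntegralPoly Ω (minpolyDiv K pb.gen) := by
    refine IsIntegralPoly.of_dvd (P := (minpoly K pb.gen).map (algebraMap K K⟮z⟯)) ?_
      ((minpoly.monic hgi).map _) (minpolyDiv_monic hgi)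
      (Dvd.intro _ (minpolyDiv_spec K pb.gen))
    intro i
    rw [coeff_map, hmin, ← IsScalarTower.algebraMap_apply]
    exact h.isIntegralPoly_minpoly hz i
  set D := aeval pb.gen (minpoly K pb.gen).derivative with hD
  have hD0 : D ≠ 0 := (Algebra.IsSeparable.isSeparable K pb.gen).aeval_derivative_ne_zero
    (minpoly.aeval _ _)
  have hDz : (D : Ω) = aeval z (minpoly K z).derivative := by
    have h1 := aeval_algebraMap_apply Ω pb.gen (minpoly K pb.gen).derivative
    rw [show algebraMap K⟮z⟯ Ω pb.gen = z from hgen] at h1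
    rw [← hmin]
    exact h1.symm
  set a' : K⟮z⟯ := ⟨a, haz⟩
  have hrepr : ∀ i, pb.basis.repr (D * a') i =
      Algebra.trace K K⟮z⟯ (a' * (minpolyDiv K pb.gen).coeff i) := by
    intro i
    conv_lhs => rw [← pb.basis.traceDual_traceDual]
    rw [Module.Basis.traceDual_repr_apply, Algebra.traceForm_apply,
      Module.Basis.traceDual_powerBasis_eq, ← hD]
    congr 1
    field_simp
  refine ⟨∑ i, C (pb.basis.repr (D * a') i) * X ^ (i : ℕ), ?_, ?_⟩
  · rw [isIntegralPoly_iff]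
    refine sum_mem fun i _ => ?_
    rw [← isIntegralPoly_iff]
    intro j
    rw [coeff_C_mul_X_pow]
    split_ifs
    · rw [hrepr]
      exact norm_trace_le h (norm_mul_le_of_le_one ha (hdiv i))
    · simp
  · have hs := congrArg (algebraMap K⟮z⟯ Ω) (pb.basis.sum_repr (D * a'))
    rw [map_sum] at hs
    rw [map_sum, ← hDz]
    refine Eq.trans ?_ (hs.trans (map_mul (algebraMap K⟮z⟯ Ω) D a'))
    refine Finset.sum_congr rfl fun i _ => ?_
    generalize pb.basis.repr (D * a') i = c
    rw [Algebra.smul_def, pb.basis_eq_pow, map_mul, map_mul, map_pow, map_pow, aeval_C, aeval_X,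
      ← IsScalarTower.algebraMap_apply]
    exact congrArg (fun w => algebraMap K Ω c * w ^ (i : ℕ)) hgen.symm

variable (K) in
theorem exists_trace_eq_one (z : Ω) :
    ∃ (u : K⟮z⟯) (m : ℕ), Algebra.trace K K⟮z⟯ u = 1 ∧
      (u : Ω) = z ^ m / aeval z (minpoly K z).derivative := by
  have := isGalois_of_isAlgClosed K Ω
  have hzi : IsIntegral K z := Algebra.IsIntegral.isIntegral z
  have : FiniteDimensional K K⟮z⟯ := IntermediateField.adjoin.finiteDimensional hzi
  let pb := IntermediateField.adjoin.powerBasis hzi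
  have hgen : (pb.gen : Ω) = z := by
    simp [pb, IntermediateField.adjoin.powerBasis_gen]
  have hmin : minpoly K pb.gen = minpoly K z := by
    rw [← minpoly.algebraMap_eq (algebraMap K⟮z⟯ Ω).injective pb.gen]
    exact congrArg _ hgen
  have hgi : IsIntegral K pb.gen := Algebra.IsIntegral.isIntegral _
  have hdim := natDegree_minpolyDiv_succ hgi
  rw [pb.natDegree_minpoly] at hdim
  let i : Fin pb.dim := ⟨(minpolyDiv K pb.gen).natDegree, by omega⟩
  have ht := pb.basis.trace_mul_traceDual i i
  rw [if_pos rfl, Module.Basis.traceDual_powerBasis_eq, (minpolyDiv_monic hgi).coeff_natDegree,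
    pb.basis_eq_pow, mul_one_div] at ht
  refine ⟨pb.gen ^ (i : ℕ) / aeval pb.gen (minpoly K pb.gen).derivative, i, ht, ?_⟩
  have h1 := aeval_algebraMap_apply Ω pb.gen (minpoly K pb.gen).derivative
  rw [show algebraMap K⟮z⟯ Ω pb.gen = z from hgen, hmin] at h1
  have h2 := map_div₀ (algebraMap K⟮z⟯ Ω) (pb.gen ^ (i : ℕ))
    (aeval pb.gen (minpoly K z).derivative)
  rw [← h1, map_pow, show algebraMap K⟮z⟯ Ω pb.gen = z from hgen, ← hmin] at h2
  rw [← hmin]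
  exact h2

end Galois

section Nondiscrete

variable {Ω : Type*} [NormedField Ω] {K : Type*} [Field K] [Algebra K Ω]

variable (Ω K) in
/-- The elements of `K` have norms in `Ω` below one and arbitrarily close to one. -/
def HasNormsNearOne : Prop :=
  ∀ r < (1 : ℝ), ∃ a : K, r < ‖algebraMap K Ω a‖ ∧ ‖algebraMap K Ω a‖ < 1

theorem HasNormsNearOne.intermediateField (h : HasNormsNearOne Ω K) (L : IntermediateField K Ω) :
    HasNormsNearOne Ω L := by
  intro r hr
  obtain ⟨a, ha⟩ := h r hr
  exact ⟨algebraMap K L a, ha⟩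

theorem HasNormsNearOne.exists_lt_pow (h : HasNormsNearOne Ω K) {r : ℝ} (hr : r < 1) {n : ℕ}
    (hn : n ≠ 0) : ∃ a : K, r < ‖algebraMap K Ω a‖ ^ n ∧ ‖algebraMap K Ω a‖ < 1 := by
  have hn' : (1 : ℝ) ≤ n := by exact_mod_cast Nat.one_le_iff_ne_zero.mpr hn
  obtain ⟨a, ha, ha1⟩ := h (1 - (1 - max r 0) / n) (by
    have : 0 < (1 - max r 0) / n := div_pos (by simp [hr]) (by linarith)
    linarith)
  refine ⟨a, ?_, ha1⟩
  have h1 : (1 - max r 0) / n ≤ 1 :=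
    (div_le_self (by simp [hr.le]) hn').trans (by simp)
  have h2 := one_add_mul_le_pow (a := -((1 - max r 0) / n)) (by linarith) n
  have h3 : 1 + (n : ℝ) * -((1 - max r 0) / n) = max r 0 := by field_simp; ring
  rw [h3, ← sub_eq_add_neg] at h2
  exact (le_max_left r 0).trans_lt (h2.trans_lt (pow_lt_pow_left₀ ha (by linarith) hn))

/-- There are elements of `K` whose norm lies between the `2N`-th and the `N`-th root of `ε`. -/
theorem HasNormsNearOne.exists_pow_mem_Icc (h : HasNormsNearOne Ω K) {ε : ℝ} (h0 : 0 < ε)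
    (h1 : ε < 1) {N : ℕ} (hN : N ≠ 0) :
    ∃ s : K, ε ≤ ‖algebraMap K Ω s‖ ^ N ∧ (‖algebraMap K Ω s‖ ^ N) ^ 2 ≤ ε := by
  obtain ⟨a, ha, ha1⟩ := h.exists_lt_pow h1 (mul_ne_zero hN two_ne_zero)
  set α := ‖algebraMap K Ω a‖ ^ (N * 2) with hα
  have hα1 : α < 1 := pow_lt_one₀ (norm_nonneg _) ha1 (mul_ne_zero hN two_ne_zero)
  classical
  have hex : ∃ j : ℕ, α ^ j ≤ ε := (exists_pow_lt_of_lt_one h0 hα1).imp fun _ => le_of_lt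
  obtain ⟨j, hj⟩ : ∃ j, Nat.find hex = j + 1 := by
    refine Nat.exists_eq_succ_of_ne_zero fun h0 => ?_
    have := Nat.find_spec hex
    rw [h0, pow_zero] at this
    linarith
  have hle := Nat.find_spec hex
  have hlt := not_le.mp (Nat.find_min hex (m := j) (by omega))
  rw [hj] at hle
  have hsq : (‖algebraMap K Ω (a ^ (j + 1))‖ ^ N) ^ 2 = α ^ (j + 1) := by
    rw [hα, map_pow, norm_pow]; ring
  refine ⟨a ^ (j + 1), ?_, hsq.trans_le hle⟩
  refine le_of_sq_le_sq ?_ (by positivity)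
  rw [hsq, pow_succ α, sq]
  exact mul_le_mul hlt.le ha.le h0.le (h0.trans hlt).le

variable [IsUltrametricDist Ω] {p : ℕ}

/-- If integral elements are `p`-th powers up to an error of norm at most some `c < 1`, then they
are `p`-th powers modulo `p`. -/
theorem IsFrobeniusSurjective.of_approx (hp : p.Prime) (hp0 : 0 < ‖(p : Ω)‖)
    (hd : HasNormsNearOne Ω K) {c : ℝ} (hc : c < 1)
    (h : ∀ a : K, ‖algebraMap K Ω a‖ ≤ 1 → ∃ b : K, ‖algebraMap K Ω (a - b ^ p)‖ ≤ c) :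
    IsFrobeniusSurjective Ω K p := by
  obtain ⟨b₀, hb₀, hb₁⟩ := hd.exists_lt_pow (r := max c 0) (max_lt hc one_pos) hp.ne_zero
  set δ := ‖algebraMap K Ω b₀‖ ^ p with hδ
  have hδ0 : 0 < δ := (le_max_right _ _).trans_lt hb₀
  have hcδ : c ≤ δ := ((le_max_left _ _).trans_lt hb₀).le
  have hδ1 : δ < 1 := pow_lt_one₀ (norm_nonneg _) hb₁ hp.ne_zero
  have hb0 : algebraMap K Ω b₀ ≠ 0 := by
    intro h0
    rw [hδ, h0, norm_zero, zero_pow hp.ne_zero] at hδ0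
    exact hδ0.false
  have hb0' : b₀ ≠ 0 := fun h0 => hb0 (by simp [h0])
  have key : ∀ (k : ℕ) (a : K), ‖algebraMap K Ω a‖ ≤ 1 →
      ∃ b : K, ‖algebraMap K Ω (a - b ^ p)‖ ≤ max (δ ^ k) ‖(p : Ω)‖ := by
    intro k
    induction k with
    | zero => exact fun a ha => ⟨0, by simp [hp.ne_zero, ha]⟩
    | succ k ih =>
      intro a ha
      obtain ⟨y, hy⟩ := h a ha
      have hy1 : ‖algebraMap K Ω y‖ ≤ 1 := by
        refine norm_le_one_of_norm_sub_pow_le hp.ne_zero ha ?_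
        rw [← map_pow, ← map_sub]
        exact hy.trans hc.le
      obtain ⟨e, he⟩ : ∃ e, a - y ^ p = b₀ ^ p * e :=
        ⟨(a - y ^ p) / b₀ ^ p, by field_simp⟩
      have he1 : ‖algebraMap K Ω e‖ ≤ 1 := by
        have := hy.trans hcδ
        rw [he, map_mul, norm_mul, map_pow, norm_pow, ← hδ] at this
        exact le_of_mul_le_mul_left (by rwa [mul_one]) hδ0
      obtain ⟨w, hw⟩ := ih e he1
      have hw1 : ‖algebraMap K Ω w‖ ≤ 1 := by
        refine norm_le_one_of_norm_sub_pow_le hp.ne_zero he1 ?_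
        rw [← map_pow, ← map_sub]
        exact hw.trans (max_le (pow_le_one₀ hδ0.le hδ1.le)
          (IsUltrametricDist.norm_natCast_le_one Ω p))
      refine ⟨y + b₀ * w, ?_⟩
      have hadd := norm_add_pow_prime_sub_le hp hy1
        (norm_mul_le_of_le_one hb₁.le hw1 : ‖algebraMap K Ω b₀ * algebraMap K Ω w‖ ≤ 1)
      have heq : algebraMap K Ω (a - (y + b₀ * w) ^ p) =
          algebraMap K Ω b₀ ^ p * algebraMap K Ω (e - w ^ p) -
          ((algebraMap K Ω y + algebraMap K Ω b₀ * algebraMap K Ω w) ^ p -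
            (algebraMap K Ω y ^ p + (algebraMap K Ω b₀ * algebraMap K Ω w) ^ p)) := by
        rw [show a = y ^ p + b₀ ^ p * e by rw [← he]; ring]
        simp only [map_sub, map_add, map_mul, map_pow]
        ring
      rw [heq]
      refine ultrametric_norm_sub_le ?_ (hadd.trans (le_max_right _ _))
      rw [norm_mul, norm_pow, ← hδ, pow_succ']
      refine (mul_le_mul_of_nonneg_left hw hδ0.le).trans ?_
      rw [mul_max_of_nonneg _ _ hδ0.le]
      exact max_le_max le_rfl (mul_le_of_le_one_left (norm_nonneg _) hδ1.le)
  obtain ⟨k, hk⟩ := exists_pow_lt_of_lt_one hp0 hδ1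
  intro a ha
  obtain ⟨b, hb⟩ := key k a ha
  exact ⟨b, hb.trans (max_le hk.le le_rfl)⟩

end Nondiscrete

section Step

variable {Ω : Type*} [NormedField Ω] [IsUltrametricDist Ω] [IsAlgClosed Ω]
  {K : Type*} [Field K] [Algebra K Ω] [Algebra.IsAlgebraic K Ω] [CharZero K] {p : ℕ}

/-- A version of Krasner's lemma for approximate `p`-th roots. -/
theorem exists_pow_close_mem_adjoin (hp : p.Prime) (hG : IsGaloisInvariantNorm Ω K)
    (hK : IsFrobeniusSurjective Ω K p) {R : K[X]} (hRm : R.Monic) (hRi : IsIntegralPoly Ω R)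
    (hRd : R.natDegree ≠ 0) {τ : ℝ} (hτ0 : 0 ≤ τ) (hτ1 : τ ≤ 1)
    (hR : ∀ w : Ω, ‖w‖ ≤ 1 → ‖aeval w R.derivative‖ = τ)
    (hpτ : ‖(p : Ω)‖ < τ ^ R.natDegree) {z : Ω} (hz : aeval z R = 0) :
    ∃ z₁ ∈ K⟮z⟯, ‖z₁‖ ≤ 1 ∧ ‖z - z₁ ^ p‖ < τ := by
  obtain ⟨R₁, hR₁m, hR₁d, hR₁i, hR₁⟩ := hK.exists_poly hp 1 hRm hRi
  have hz1 := hRi.norm_le_one_of_root hRm hz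
  obtain ⟨z₁, hz₁, hzz₁⟩ := exists_root_pow_close hp hR₁m (hR₁d ▸ hRd) hR₁i hR₁ hz1 hz
  rw [hR₁d, pow_one] at hzz₁
  have hlt : ‖z - z₁ ^ p‖ < τ := lt_of_pow_lt_pow_left₀ _ hτ0 (hzz₁.trans_lt hpτ)
  have hpτ' : ‖(p : Ω)‖ < τ := hpτ.trans_le (pow_le_of_le_one hτ0 hτ1 hRd)
  have hz₁1 := hR₁i.norm_le_one_of_root hR₁m hz₁
  refine ⟨z₁, ?_, hz₁1, hlt⟩
  have := isGalois_of_isAlgClosed K⟮z⟯ Ω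
  have hfix : ∀ σ : Ω ≃ₐ[K⟮z⟯] Ω, σ z₁ = z₁ := by
    intro σ
    by_contra hne
    have hσz : σ z = z := σ.commutes ⟨z, IntermediateField.mem_adjoin_simple_self K z⟩
    have hσ1 : ‖σ z₁‖ ≤ 1 := (hG.intermediateField _ σ z₁).trans_le hz₁1
    have hσ₁ : aeval (σ z₁) R₁ = 0 := by
      have := aeval_algHom_apply ((σ.restrictScalars K : Ω ≃ₐ[K] Ω) : Ω →ₐ[K] Ω) z₁ R₁
      rw [hz₁, map_zero] at this
      exact this
    have hder := norm_aeval_derivative_le_of_roots hR₁i hR₁m hz₁ hσ₁ (Ne.symm hne)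
    have hcong := norm_aeval_pow_sub_aeval_le (A := R.derivative) (B := R₁.derivative) (n := 1) hp
      hR₁i.derivative (by
        intro i
        have := norm_derivative_coeff_sub_pow_le (Ω := Ω) hp (A := R) hR₁i
          (by simpa only [pow_one] using hR₁) i
        simpa only [pow_one] using this) hz₁1
    rw [pow_one] at hcong
    have hclose : ‖z₁ ^ p - σ z₁ ^ p‖ ≤ ‖z - z₁ ^ p‖ := by
      refine ultrametric_norm_sub_le_trans (y := z) (norm_sub_rev _ _).le ?_
      rw [← hG.intermediateField _ σ (z - z₁ ^ p), map_sub, map_pow, hσz]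
    have hpow := norm_pow_prime_pow_sub_le hp hz₁1 hσ1 1
    rw [pow_one, norm_pow] at hpow
    have h1 : ‖aeval z₁ R₁.derivative ^ p‖ < τ := by
      rw [norm_pow]
      exact (pow_le_pow_left₀ (norm_nonneg _) hder p).trans_lt
        (hpow.trans_lt (max_lt (hclose.trans_lt hlt) hpτ'))
    have h2 := hR _ (norm_pow_le_one_of_le hz₁1 p)
    have h3 := ultrametric_norm_sub_le (le_max_left ‖aeval z₁ R₁.derivative ^ p‖ ‖(p : Ω)‖)
      (hcong.trans (le_max_right _ _))
    rw [sub_sub_cancel, h2] at h3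
    exact absurd (h3.trans_lt (max_lt h1 hpτ')) (lt_irrefl _)
  obtain ⟨w, hw⟩ := (InfiniteGalois.mem_range_algebraMap_iff_fixed (k := K⟮z⟯) z₁).mpr hfix
  exact hw ▸ w.2

theorem IsFrobeniusSurjective.adjoin_root (hp : p.Prime) (hp0 : 0 < ‖(p : Ω)‖)
    (hG : IsGaloisInvariantNorm Ω K) (hd : HasNormsNearOne Ω K)
    (hK : IsFrobeniusSurjective Ω K p) {R : K[X]} (hRm : R.Monic) (hRi : IsIntegralPoly Ω R)
    (hRd : R.natDegree ≠ 0) {s : K} (hs1 : ‖algebraMap K Ω s‖ ≤ 1)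
    (hR : ∀ w : Ω, ‖w‖ ≤ 1 → ‖aeval w R.derivative‖ = ‖algebraMap K Ω (s ^ p)‖)
    (hps : ‖(p : Ω)‖ < ‖algebraMap K Ω (s ^ p)‖ ^ R.natDegree) {z : Ω} (hz : aeval z R = 0) :
    IsFrobeniusSurjective Ω K⟮z⟯ p := by
  set t := algebraMap K Ω (s ^ p) with ht
  have ht1 : ‖t‖ ≤ 1 := by rw [ht, map_pow]; exact norm_pow_le_one_of_le hs1 p
  obtain ⟨z₁, hz₁L, hz₁, hzz₁⟩ := exists_pow_close_mem_adjoin hp hG hK hRm hRi hRd (norm_nonneg t)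
    ht1 hR hps hz
  have hpt : ‖(p : Ω)‖ < ‖t‖ := hps.trans_le (pow_le_of_le_one (norm_nonneg _) ht1 hRd)
  have ht0 : t ≠ 0 := norm_pos_iff.mp (hp0.trans hpt)
  have hs0 : algebraMap K Ω s ≠ 0 := fun h => ht0 (by rw [ht, map_pow, h, zero_pow hp.ne_zero])
  have hz1 := hRi.norm_le_one_of_root hRm hz
  have hzi : IsIntegral K z := Algebra.IsIntegral.isIntegral z
  have hder : ‖t‖ ≤ ‖aeval z (minpoly K z).derivative‖ := by
    rw [← hR z hz1]
    exact norm_aeval_derivative_le_of_dvd hRi hRm (minpoly.monic hzi) (minpoly.dvd K z hz)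
      (minpoly.aeval K z)
  set f' := aeval z (minpoly K z).derivative with hf'
  have hf'0 : f' ≠ 0 := norm_pos_iff.mp ((hp0.trans hpt).trans_le hder)
  have hzL : z ∈ K⟮z⟯ := IntermediateField.mem_adjoin_simple_self K z
  have hevalL : ∀ (w : Ω) (_ : w ∈ K⟮z⟯) (P : K[X]), aeval w P ∈ K⟮z⟯ := fun w hw P => by
    have := aeval_algebraMap_apply Ω (⟨w, hw⟩ : K⟮z⟯) P
    exact this ▸ (aeval (⟨w, hw⟩ : K⟮z⟯) P).2
  set m := max ‖z - z₁ ^ p‖ ‖(p : Ω)‖ with hm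
  refine IsFrobeniusSurjective.of_approx (c := m / ‖t‖) hp hp0 (hd.intermediateField _)
    ((div_lt_one (norm_pos_iff.mpr ht0)).mpr (max_lt hzz₁ hpt)) fun a ha => ?_
  obtain ⟨g, hg, hgz⟩ := exists_aeval_eq_derivative_minpoly_mul hG hz1 (a := t * a / f')
    (div_mem (mul_mem (IntermediateField.algebraMap_mem _ _) a.2) (hevalL z hzL _)) (by
      rw [norm_div, norm_mul, div_le_one (norm_pos_iff.mpr hf'0)]
      exact (mul_le_of_le_one_right (norm_nonneg _) ha).trans hder)
  rw [← hf', mul_div_cancel₀ _ hf'0] at hgz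
  set N := g.natDegree + 1
  have hPi : IsIntegralPoly Ω (X ^ N + g) := by
    refine IsIntegralPoly.add ?_ hg
    intro i
    rw [coeff_X_pow]
    split_ifs <;> simp
  obtain ⟨Q, -, -, hQi, hQ⟩ := hK.exists_poly hp 1 (monic_X_pow_add (p := g) (n := N)
    (degree_le_natDegree.trans_lt (by exact_mod_cast Nat.lt_succ_self _))) hPi
  have hQe := norm_aeval_pow_sub_aeval_le hp hQi hQ hz₁
  rw [pow_one, map_add, map_pow, aeval_X] at hQe
  set w := aeval z₁ Q - z₁ ^ N with hw
  have hz₁N := norm_pow_le_one_of_le hz₁ N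
  have hwadd := norm_add_pow_prime_sub_le hp
    (ultrametric_norm_sub_le (hQi.norm_aeval_le_one hz₁) hz₁N) hz₁N
  rw [sub_add_cancel, ← hw] at hwadd
  have hgg := hg.norm_aeval_sub_aeval_le hz1 (norm_pow_le_one_of_le hz₁ p)
  have key : ‖t * a - w ^ p‖ ≤ m := by
    have heq : t * a - w ^ p = (aeval z g - aeval (z₁ ^ p) g) +
        ((aeval z₁ Q ^ p - (w ^ p + (z₁ ^ N) ^ p)) -
          (aeval z₁ Q ^ p - ((z₁ ^ p) ^ N + aeval (z₁ ^ p) g))) := by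
      rw [hgz]; ring
    rw [heq]
    exact ultrametric_norm_add_le (hgg.trans (le_max_left _ _))
      ((ultrametric_norm_sub_le hwadd hQe).trans (le_max_right _ _))
  refine ⟨⟨w / algebraMap K Ω s, div_mem (sub_mem (hevalL z₁ hz₁L Q) (pow_mem hz₁L N))
    (IntermediateField.algebraMap_mem _ _)⟩, ?_⟩
  have heq : (a : Ω) - (w / algebraMap K Ω s) ^ p = (t * a - w ^ p) / t := by
    rw [ht, map_pow, div_pow, sub_div, mul_div_cancel_left₀ _ (pow_ne_zero p hs0)]
  change ‖(a : Ω) - (w / algebraMap K Ω s) ^ p‖ ≤ _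
  rw [heq, norm_div]
  exact div_le_div_of_nonneg_right key (norm_nonneg _)

theorem exists_trace_eq_of_norm_le {R : K[X]} (hRm : R.Monic)
    (hRi : IsIntegralPoly Ω R) {z : Ω} (hz : aeval z R = 0) {k : K}
    (hk : ‖algebraMap K Ω k‖ ≤ ‖aeval z R.derivative‖) :
    ∃ u : K⟮z⟯, ‖(u : Ω)‖ ≤ 1 ∧ Algebra.trace K K⟮z⟯ u = k := by
  obtain ⟨u, m, hu, hum⟩ := exists_trace_eq_one K z
  refine ⟨k • u, ?_, by rw [map_smul, hu, smul_eq_mul, mul_one]⟩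
  have hzi : IsIntegral K z := Algebra.IsIntegral.isIntegral z
  have hder := norm_aeval_derivative_le_of_dvd hRi hRm (minpoly.monic hzi) (minpoly.dvd K z hz)
      (minpoly.aeval K z)
  rw [IntermediateField.coe_smul, hum, Algebra.smul_def, mul_div_left_comm]
  refine norm_mul_le_of_le_one (norm_pow_le_one_of_le (hRi.norm_le_one_of_root hRm hz) m) ?_
  rw [norm_div]
  exact div_le_one_of_le₀ (hk.trans hder) (norm_nonneg _)

end Step

section Approximation

variable {Ω : Type*} [NormedField Ω] [IsUltrametricDist Ω] [IsAlgClosed Ω]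
  {K : Type*} [Field K] [Algebra K Ω] [Algebra.IsAlgebraic K Ω] [CharZero K] {p : ℕ}

theorem IsFrobeniusSurjective.exists_approx (hp : p.Prime) (hp0 : 0 < ‖(p : Ω)‖)
    (hp1 : ‖(p : Ω)‖ < 1) (hG : IsGaloisInvariantNorm Ω K) (hd : HasNormsNearOne Ω K)
    (hK : IsFrobeniusSurjective Ω K p) {d : ℕ} {c k : K} (hc1 : ‖algebraMap K Ω c‖ ≤ 1)
    (hc : ‖(p : Ω)‖ ≤ ‖algebraMap K Ω c‖ ^ (2 * (p * d))) (hk : ‖algebraMap K Ω k‖ < 1) {x : Ω}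
    (hx : ‖x‖ ≤ 1) (hxd : (minpoly K x).natDegree ≤ d) :
    ∃ L : IntermediateField K Ω, FiniteDimensional K L ∧ IsFrobeniusSurjective Ω L p ∧
      (∃ y ∈ L, ‖x - y‖ ≤ ‖algebraMap K Ω c‖) ∧
      ∃ u : L, ‖(u : Ω)‖ ≤ 1 ∧ Algebra.trace K L u = k := by
  have hxi : IsIntegral K x := Algebra.IsIntegral.isIntegral x
  have hPm := minpoly.monic hxi
  have hPi := hG.isIntegralPoly_minpoly hx
  have hP0 : (minpoly K x).natDegree ≠ 0 := (minpoly.natDegree_pos hxi).ne'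
  set P := minpoly K x with hP
  set D := p * P.natDegree with hD
  have hD0 : D ≠ 0 := mul_ne_zero hp.ne_zero hP0
  obtain ⟨n₀, hn₀⟩ := exists_pow_lt_of_lt_one hp0 hk
  obtain ⟨n, hn⟩ : ∃ n, n = n₀ + D := ⟨_, rfl⟩
  set q := p ^ n with hq
  have hnq : n < q := Nat.lt_pow_self hp.one_lt
  have hq0 : q ≠ 0 := (pow_pos hp.pos n).ne'
  obtain ⟨s, hs, hs'⟩ := hd.exists_pow_mem_Icc hp0 hp1 (mul_ne_zero hp.ne_zero hq0)
  set t := algebraMap K Ω (s ^ p) with ht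
  have htq : ‖algebraMap K Ω s‖ ^ (p * q) = ‖t‖ ^ q := by
    rw [ht, map_pow, norm_pow, ← pow_mul]
  rw [htq] at hs hs'
  have ht1 : ‖t‖ < 1 := by
    by_contra! h
    exact (hs'.trans_lt hp1).not_ge (one_le_pow₀ (one_le_pow₀ h))
  have ht0 : 0 < ‖t‖ := by
    refine (norm_nonneg t).lt_of_ne fun h => ?_
    rw [← h, zero_pow hq0] at hs
    exact hs.not_gt hp0
  have hs1 : ‖algebraMap K Ω s‖ ≤ 1 := by
    rw [ht, map_pow, norm_pow] at ht1
    exact (lt_of_pow_lt_pow_left₀ p zero_le_one (by rwa [one_pow])).le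
  have hpt : ‖(p : Ω)‖ < ‖t‖ ^ D :=
    hs.trans_lt (pow_lt_pow_right_of_lt_one₀ ht0 ht1 (by omega))
  have hpt' : ‖(p : Ω)‖ < ‖t‖ := hpt.trans_le (pow_le_of_le_one ht0.le ht1.le hD0)
  have hkt : ‖algebraMap K Ω k‖ ≤ ‖t‖ := by
    refine le_of_pow_le_pow_left₀ hq0 ht0.le (le_trans ?_ hs)
    exact (pow_le_pow_of_le_one (norm_nonneg _) hk.le (by omega)).trans hn₀.le
  obtain ⟨Q, hQm, hQd, hQi, hQ⟩ := hK.exists_poly hp n hPm hPi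
  have hQpd : (Q ^ p).natDegree = D := by rw [hQm.natDegree_pow, hQd, hD]
  have hdeg : (C (s ^ p) * X : K[X]).natDegree < (Q ^ p).natDegree := by
    refine (natDegree_C_mul_le _ _).trans_lt ?_
    rw [natDegree_X]
    rw [hQpd, hD]
    exact hp.one_lt.trans_le (Nat.le_mul_of_pos_right p (Nat.pos_of_ne_zero hP0))
  set R := Q ^ p + C (s ^ p) * X with hRdef
  have hRm : R.Monic := (hQm.pow p).add_of_left (degree_lt_degree hdeg)
  have hRd : R.natDegree = D := by rw [hRdef, natDegree_add_eq_left_of_natDegree_lt hdeg, hQpd]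
  have hRi : IsIntegralPoly Ω R := (hQi.pow p).add (IsIntegralPoly.C_mul_X ht1.le)
  have hRder : ∀ w : Ω, ‖w‖ ≤ 1 → ‖aeval w R.derivative‖ = ‖t‖ := by
    intro w hw
    have heq : aeval w R.derivative =
        aeval w Q ^ (p - 1) * aeval w Q.derivative * (p : Ω) + t := by
      rw [hRdef, derivative_add, derivative_pow, derivative_C_mul, derivative_X]
      simp [ht]
      ring
    have hlt : ‖aeval w Q ^ (p - 1) * aeval w Q.derivative * (p : Ω)‖ < ‖t‖ :=
      (norm_mul_le_of_le_one (norm_mul_le_of_le_one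
        (norm_pow_le_one_of_le (hQi.norm_aeval_le_one hw) _)
        (hQi.derivative.norm_aeval_le_one hw)) le_rfl).trans_lt hpt'
    rw [heq, IsUltrametricDist.norm_add_eq_max_of_norm_ne_norm hlt.ne, max_eq_right hlt.le]
  obtain ⟨ξ, hξ⟩ := IsAlgClosed.exists_pow_nat_eq x (Nat.pos_of_ne_zero hq0)
  have hξ1 : ‖ξ‖ ≤ 1 := by
    rw [← hξ, norm_pow] at hx
    exact (pow_le_one_iff_of_nonneg (norm_nonneg _) hq0).mp hx
  have hQξ : ‖aeval ξ Q‖ ≤ ‖t‖ := by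
    have h := norm_aeval_pow_sub_aeval_le hp hQi hQ hξ1
    rw [← hq, hξ, hP, minpoly.aeval, sub_zero, norm_pow] at h
    exact le_of_pow_le_pow_left₀ hq0 ht0.le (h.trans hs)
  have hRξ : ‖aeval ξ R‖ ≤ ‖t‖ := by
    rw [hRdef, map_add, map_pow, map_mul, aeval_C, aeval_X]
    refine ultrametric_norm_add_le ?_ (by rw [mul_comm]; exact norm_mul_le_of_le_one hξ1 le_rfl)
    rw [norm_pow]
    exact (pow_le_of_le_one (norm_nonneg _) (hQi.norm_aeval_le_one hξ1) hp.ne_zero).trans hQξ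
  obtain ⟨z, hz, hξz⟩ := exists_root_norm_sub_pow_le hRm (hRd ▸ hD0) ξ
  have hz1 := hRi.norm_le_one_of_root hRm hz
  refine ⟨K⟮z⟯, IntermediateField.adjoin.finiteDimensional (Algebra.IsIntegral.isIntegral z),
    hK.adjoin_root hp hp0 hG hd hRm hRi (hRd ▸ hD0) hs1 hRder (hRd ▸ hpt) hz,
    ⟨z ^ q, pow_mem (IntermediateField.mem_adjoin_simple_self K z) q, ?_⟩,
    exists_trace_eq_of_norm_le hRm hRi hz (hkt.trans (hRder z hz1).ge)⟩
  rw [hRd] at hξz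
  have hξzt := hξz.trans hRξ
  have hpc : ‖(p : Ω)‖ ≤ ‖algebraMap K Ω c‖ ^ (2 * D) :=
    hc.trans (pow_le_pow_of_le_one (norm_nonneg _) hc1 (by rw [hD]; gcongr))
  have h2D : 2 * D ≠ 0 := mul_ne_zero two_ne_zero hD0
  rw [← hξ]
  refine (norm_pow_sub_pow_le_max hp hξ1 hz1 n).trans (max_le ?_ ?_)
  · refine le_of_pow_le_pow_left₀ h2D (norm_nonneg _) (le_trans ?_ hpc)
    refine le_trans ?_ hs'
    calc (‖ξ - z‖ ^ p ^ n) ^ (2 * D) = ((‖ξ - z‖ ^ D) ^ q) ^ 2 := by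
          rw [← hq, ← pow_mul, ← pow_mul, ← pow_mul]; congr 1; ring
      _ ≤ (‖t‖ ^ q) ^ 2 := by gcongr
  · exact hpc.trans (pow_le_of_le_one (norm_nonneg _) hc1 h2D)

end Approximation

section Iteration

universe u
variable {Ω : Type u} [NormedField Ω] [IsUltrametricDist Ω] [IsAlgClosed Ω] {p : ℕ}

theorem natDegree_minpoly_div_le {K Ω : Type*} [Field K] [Field Ω] [Algebra K Ω]
    [Algebra.IsAlgebraic K Ω] (L : IntermediateField K Ω) (x y c : Ω) (hy : y ∈ L) (hc : c ∈ L) :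
    (minpoly L ((x - y) / c)).natDegree ≤ (minpoly K x).natDegree := by
  have hxi : IsIntegral K x := Algebra.IsIntegral.isIntegral x
  have hxi' : IsIntegral L x := hxi.tower_top
  have hmem : (x - y) / c ∈ L⟮x⟯ :=
    div_mem (sub_mem (IntermediateField.mem_adjoin_simple_self L x)
      (IntermediateField.algebraMap_mem _ (⟨y, hy⟩ : L)))
      (IntermediateField.algebraMap_mem _ (⟨c, hc⟩ : L))
  have : FiniteDimensional L L⟮x⟯ := IntermediateField.adjoin.finiteDimensional hxi'
  have h1 := minpoly.natDegree_le (A := L) (⟨_, hmem⟩ : L⟮x⟯)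
  rw [IntermediateField.adjoin.finrank hxi',
    ← minpoly.algebraMap_eq (algebraMap L⟮x⟯ Ω).injective] at h1
  refine h1.trans ((natDegree_le_of_dvd (minpoly.dvd_map_of_isScalarTower K L x) ?_).trans
    natDegree_map_le)
  exact ((minpoly.monic hxi).map _).ne_zero

theorem IsFrobeniusSurjective.exists_approx_pow (hp : p.Prime) (hp0 : 0 < ‖(p : Ω)‖)
    (hp1 : ‖(p : Ω)‖ < 1) {d : ℕ} (N : ℕ) : ∀ {K : Type u} [Field K] [Algebra K Ω]
    [Algebra.IsAlgebraic K Ω] [CharZero K] (_ : IsGaloisInvariantNorm Ω K)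
    (_ : HasNormsNearOne Ω K) (_ : IsFrobeniusSurjective Ω K p)
    {c k : K} (_ : c ≠ 0) (_ : ‖algebraMap K Ω c‖ ≤ 1)
    (_ : ‖(p : Ω)‖ ≤ ‖algebraMap K Ω c‖ ^ (2 * (p * d))) (_ : ‖algebraMap K Ω k‖ < 1) {x : Ω}
    (_ : ‖x‖ ≤ 1) (_ : (minpoly K x).natDegree ≤ d),
    ∃ L : IntermediateField K Ω, FiniteDimensional K L ∧ IsFrobeniusSurjective Ω L p ∧
      (∃ y ∈ L, ‖x - y‖ ≤ ‖algebraMap K Ω c‖ ^ N) ∧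
      ∃ u : L, ‖(u : Ω)‖ ≤ 1 ∧ Algebra.trace K L u = k ^ N := by
  induction N with
  | zero =>
    intro K _ _ _ _ hG hd hK c k hc0 hc1 hc hk x hx hxd
    refine ⟨⊥, inferInstance, ?_, ⟨0, zero_mem _, by simpa using hx⟩, 1, by simp, ?_⟩
    · intro a ha
      obtain ⟨a', ha'⟩ := IntermediateField.mem_bot.mp a.2
      obtain ⟨b, hb⟩ := hK a' (by rw [ha']; exact ha)
      refine ⟨algebraMap K _ b, ?_⟩
      rw [map_sub, map_pow, ha'] at hb
      exact hb
    · rw [← map_one (algebraMap K (⊥ : IntermediateField K Ω)), Algebra.trace_algebraMap,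
        IntermediateField.finrank_bot, one_smul, pow_zero]
  | succ N ih =>
    intro K _ _ _ _ hG hd hK c k hc0 hc1 hc hk x hx hxd
    obtain ⟨L₁, hL₁, hL₁p, ⟨y₁, hy₁L, hy₁⟩, u₁, hu₁, hu₁k⟩ :=
      hK.exists_approx hp hp0 hp1 hG hd hc1 hc hk hx hxd
    have hc0' : algebraMap K Ω c ≠ 0 := by simpa using hc0
    have hx' : ‖(x - y₁) / algebraMap K Ω c‖ ≤ 1 := by
      rw [norm_div]
      exact div_le_one_of_le₀ hy₁ (norm_nonneg _)
    obtain ⟨L₂, hL₂, hL₂p, ⟨y₂, hy₂L, hy₂⟩, u₂, hu₂, hu₂k⟩ :=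
      ih (K := L₁) (hG.intermediateField L₁) (hd.intermediateField L₁) hL₁p
        (c := algebraMap K L₁ c) (k := algebraMap K L₁ k) (by simpa using hc0) hc1 hc hk hx'
        ((natDegree_minpoly_div_le L₁ x y₁ _ hy₁L (IntermediateField.algebraMap_mem _ c)).trans hxd)
    have hfin : FiniteDimensional K L₂ := FiniteDimensional.trans K L₁ L₂
    refine ⟨L₂.restrictScalars K, hfin, hL₂p,
      ⟨y₁ + algebraMap K Ω c * y₂, ?_, ?_⟩, ?_⟩
    · exact add_mem (L₂.algebraMap_mem ⟨y₁, hy₁L⟩)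
        (mul_mem (L₂.algebraMap_mem (algebraMap K L₁ c)) hy₂L)
    · have heq : x - (y₁ + algebraMap K Ω c * y₂) =
          algebraMap K Ω c * ((x - y₁) / algebraMap K Ω c - y₂) := by field_simp; ring
      rw [heq, norm_mul, pow_succ']
      exact mul_le_mul_of_nonneg_left hy₂ (norm_nonneg _)
    · refine ⟨(u₁ • u₂ : L₂), ?_, ?_⟩
      · have : ((u₁ • u₂ : L₂) : Ω) = (u₁ : Ω) * u₂ := by
          rw [Algebra.smul_def]; rfl
        refine Eq.trans_le (congrArg norm this) (norm_mul_le_of_le_one hu₁ hu₂)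
      · have h := Algebra.trace_trace (R := K) (S := L₁) (T := L₂) (u₁ • u₂)
        rw [map_smul, hu₂k, smul_eq_mul, ← map_pow, mul_comm, ← Algebra.smul_def, map_smul, hu₁k,
          smul_eq_mul, ← pow_succ] at h
        exact h.symm

end Iteration

section Descent

universe u
variable {Ω : Type u} [NormedField Ω] [IsUltrametricDist Ω] [IsAlgClosed Ω] {p : ℕ}
  {K : Type u} [Field K] [Algebra K Ω] [Algebra.IsAlgebraic K Ω] [CharZero K]

/-- A version of Krasner's lemma. -/
theorem mem_of_norm_sub_lt_derivative_minpoly (hG : IsGaloisInvariantNorm Ω K)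
    (L : IntermediateField K Ω) {x y : Ω} (hx : ‖x‖ ≤ 1) (hy : y ∈ L)
    (h : ‖x - y‖ < ‖aeval x (minpoly K x).derivative‖) : x ∈ L := by
  have := isGalois_of_isAlgClosed L Ω
  have hxi : IsIntegral K x := Algebra.IsIntegral.isIntegral x
  obtain ⟨w, hw⟩ := (InfiniteGalois.mem_range_algebraMap_iff_fixed (k := L) x).mpr fun σ => by
    by_contra hne
    have hσ : aeval (σ x) (minpoly K x) = 0 := by
      have := aeval_algHom_apply ((σ.restrictScalars K : Ω ≃ₐ[K] Ω) : Ω →ₐ[K] Ω) x (minpoly K x)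
      rw [minpoly.aeval, map_zero] at this
      exact this
    have hder := norm_aeval_derivative_le_of_roots (hG.isIntegralPoly_minpoly hx)
      (minpoly.monic hxi) (minpoly.aeval K x) hσ (Ne.symm hne)
    have hclose : ‖x - σ x‖ ≤ ‖x - y‖ := by
      refine ultrametric_norm_sub_le_trans (y := y) le_rfl ?_
      have hσy : σ y = y := σ.commutes ⟨y, hy⟩
      rw [norm_sub_rev, ← hG.intermediateField L σ (x - y), map_sub, hσy]
    exact (hder.trans hclose).not_gt h
  exact hw ▸ w.2

theorem IsFrobeniusSurjective.adjoin_simple (hp : p.Prime) (hp0 : 0 < ‖(p : Ω)‖)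
    (hp1 : ‖(p : Ω)‖ < 1) (hG : IsGaloisInvariantNorm Ω K) (hd : HasNormsNearOne Ω K)
    (hK : IsFrobeniusSurjective Ω K p) {x : Ω} (hx : ‖x‖ ≤ 1) :
    IsFrobeniusSurjective Ω K⟮x⟯ p := by
  have hKΩ := isGalois_of_isAlgClosed K Ω
  have hxi : IsIntegral K x := Algebra.IsIntegral.isIntegral x
  have hd0 : 2 * (p * (minpoly K x).natDegree) ≠ 0 :=
    mul_ne_zero two_ne_zero (mul_ne_zero hp.ne_zero (minpoly.natDegree_pos hxi).ne')
  have hsep : 0 < ‖aeval x (minpoly K x).derivative‖ := norm_pos_iff.mpr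
    ((Algebra.IsSeparable.isSeparable K x).aeval_derivative_ne_zero (minpoly.aeval _ _))
  obtain ⟨c, hc, hc1⟩ := hd.exists_lt_pow hp1 hd0
  have hc0 : c ≠ 0 := by
    rintro rfl
    rw [map_zero, norm_zero, zero_pow hd0] at hc
    exact hc.not_gt hp0
  obtain ⟨N, hN⟩ := exists_pow_lt_of_lt_one hsep hc1
  obtain ⟨k, hk, hk1⟩ := hd.exists_lt_pow hp1 (mul_ne_zero N.succ_ne_zero hp.ne_zero)
  obtain ⟨L, hL, hLp, ⟨y, hyL, hy⟩, u, hu, huk⟩ := IsFrobeniusSurjective.exists_approx_pow hp hp0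
    hp1 (N + 1) hG hd hK hc0 hc1.le hc.le hk1 hx le_rfl
  have hxL : x ∈ L := mem_of_norm_sub_lt_derivative_minpoly hG L hx hyL
    ((hy.trans (pow_le_pow_of_le_one (norm_nonneg _) hc1.le N.le_succ)).trans_lt hN)
  have hle : K⟮x⟯ ≤ L := IntermediateField.adjoin_simple_le_iff.mpr hxL
  set E := K⟮x⟯
  set M : IntermediateField E Ω := IntermediateField.extendScalars hle
  have hKM : FiniteDimensional K M := hL
  have hEM : FiniteDimensional E M := FiniteDimensional.right K E M
  have hKE : FiniteDimensional K E := IntermediateField.adjoin.finiteDimensional hxi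
  have hGE := hG.intermediateField E
  obtain ⟨v, hv, hvk⟩ : ∃ v : M, ‖(v : Ω)‖ ≤ 1 ∧ Algebra.trace K M v = k ^ (N + 1) :=
    ⟨u, hu, huk⟩
  have hMp : IsFrobeniusSurjective Ω M p := hLp
  set τ := Algebra.trace E M v with hτ
  have hτk : ‖algebraMap K Ω k‖ ^ (N + 1) ≤ ‖(τ : Ω)‖ := by
    have h := norm_trace_le hG (L := E) (a := τ) le_rfl
    rwa [hτ, Algebra.trace_trace, hvk, map_pow, norm_pow] at h
  have hpτ : ‖(p : Ω)‖ < ‖(τ : Ω)‖ ^ p :=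
    (hk.trans_eq (pow_mul _ _ _)).trans_le (pow_le_pow_left₀ (by positivity) hτk p)
  have hτ0 : (τ : Ω) ≠ 0 := by
    intro h
    rw [h, norm_zero, zero_pow hp.ne_zero] at hpτ
    exact hpτ.not_gt hp0
  refine IsFrobeniusSurjective.of_approx (c := ‖(p : Ω)‖ / ‖(τ : Ω)‖ ^ p) hp hp0
    (hd.intermediateField _) ((div_lt_one (hp0.trans hpτ)).mpr hpτ) fun a ha => ?_
  obtain ⟨b, hb⟩ := hMp (algebraMap E M a) ha
  have hb1 : ‖(b : Ω)‖ ≤ 1 := norm_le_one_of_norm_sub_pow_le hp.ne_zero ha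
    (hb.trans hp1.le)
  set w := Algebra.trace E M (v * b)
  refine ⟨w / τ, ?_⟩
  have h1 := norm_trace_pow_sub_le hp hGE hv
  have h2 := norm_trace_pow_sub_le hp hGE (a := v * b) (norm_mul_le_of_le_one hv hb1)
  have h3 := norm_trace_le hGE (L := M) (a := v ^ p * (algebraMap E M a - b ^ p))
    (norm_mul_le_of_le_one (norm_pow_le_one_of_le hv p) hb)
  have h4 : Algebra.trace E M (v ^ p * (algebraMap E M a - b ^ p)) =
      a * Algebra.trace E M (v ^ p) - Algebra.trace E M ((v * b) ^ p) := by
    rw [mul_sub, map_sub, ← mul_pow, mul_comm, ← Algebra.smul_def, map_smul, smul_eq_mul]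
  have h5 : a - (w / τ) ^ p =
      (a * (τ ^ p - Algebra.trace E M (v ^ p)) +
        ((a * Algebra.trace E M (v ^ p) - Algebra.trace E M ((v * b) ^ p)) -
          (w ^ p - Algebra.trace E M ((v * b) ^ p)))) / τ ^ p := by
    have : τ ≠ 0 := fun h => hτ0 (by simp [h])
    rw [div_pow, eq_div_iff (pow_ne_zero p this), sub_mul, div_mul_cancel₀ _ (pow_ne_zero p this)]
    ring
  rw [h5, map_div₀, norm_div, map_pow (algebraMap E Ω) τ, norm_pow, map_add, map_mul,
    map_sub (algebraMap E Ω) (_ - _) (_ - _), ← h4]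
  refine div_le_div_of_nonneg_right ?_ (by positivity)
  exact ultrametric_norm_add_le (norm_mul_le_of_le_one ha h1) (ultrametric_norm_sub_le h3 h2)

end Descent

section FiniteExtension

universe u v

theorem exists_primitive_element_norm_le_one {Ω : Type*} [NormedField Ω] {K : Type*} [Field K]
    [CharZero K] [Algebra K Ω] {E : Type*} [Field E] [Algebra K E] [FiniteDimensional K E]
    (φ : E →ₐ[K] Ω) {ϖ : K} (h0 : ϖ ≠ 0) (h1 : ‖algebraMap K Ω ϖ‖ < 1) :
    ∃ x : E, ‖φ x‖ ≤ 1 ∧ K⟮x⟯ = ⊤ := by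
  obtain ⟨α, hα⟩ := Field.exists_primitive_element K E
  obtain ⟨m, hm⟩ := exists_pow_lt_of_lt_one (y := ‖algebraMap K Ω ϖ‖)
    (inv_pos.mpr (by positivity : 0 < ‖φ α‖ + 1)) h1
  refine ⟨ϖ ^ m • α, ?_, ?_⟩
  · rw [map_smul, Algebra.smul_def, norm_mul, map_pow, norm_pow]
    calc ‖algebraMap K Ω ϖ‖ ^ m * ‖φ α‖ ≤ (‖φ α‖ + 1)⁻¹ * (‖φ α‖ + 1) := by
          gcongr
          linarith
      _ = 1 := inv_mul_cancel₀ (by positivity)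
  · rw [eq_top_iff, ← hα, IntermediateField.adjoin_simple_le_iff]
    have h := K⟮ϖ ^ m • α⟯.smul_mem (x := (ϖ ^ m)⁻¹)
      (IntermediateField.mem_adjoin_simple_self K (ϖ ^ m • α))
    rwa [smul_smul, inv_mul_cancel₀ (pow_ne_zero m h0), one_smul] at h

variable {Ω : Type u} [NormedField Ω] [IsUltrametricDist Ω] [IsAlgClosed Ω] {p : ℕ}
  {K : Type u} [Field K] [Algebra K Ω] [Algebra.IsAlgebraic K Ω] [CharZero K]
  {E : Type v} [Field E] [Algebra K E]

theorem IsFrobeniusSurjective.exists_norm_algHom_sub_pow_le (hp : p.Prime) (hp0 : 0 < ‖(p : Ω)‖)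
    (hp1 : ‖(p : Ω)‖ < 1) (hG : IsGaloisInvariantNorm Ω K) (hd : HasNormsNearOne Ω K)
    (hK : IsFrobeniusSurjective Ω K p) (φ : E →ₐ[K] Ω) {x : E} (hx : ‖φ x‖ ≤ 1) (hxE : K⟮x⟯ = ⊤)
    (a : E) (ha : ‖φ a‖ ≤ 1) : ∃ b : E, ‖φ (a - b ^ p)‖ ≤ ‖(p : Ω)‖ := by
  have hmap : IntermediateField.map φ ⊤ = K⟮φ x⟯ := by
    rw [← hxE, IntermediateField.adjoin_map, Set.image_singleton]
  have haE : φ a ∈ K⟮φ x⟯ := hmap ▸ ⟨a, trivial, rfl⟩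
  obtain ⟨b, hb⟩ := hK.adjoin_simple hp hp0 hp1 hG hd hx ⟨φ a, haE⟩ ha
  obtain ⟨b', -, hb'⟩ : (b : Ω) ∈ IntermediateField.map φ ⊤ := by
    rw [hmap]
    exact b.2
  refine ⟨b', ?_⟩
  rw [map_sub, map_pow]
  change ‖φ a - (b : Ω) ^ p‖ ≤ _ at hb
  rw [← hb'] at hb
  exact hb

theorem exists_aeval_eq_derivative_minpoly_mul_of_algHom (hG : IsGaloisInvariantNorm Ω K)
    (φ : E →ₐ[K] Ω) {x : E} (hx : ‖φ x‖ ≤ 1) (hxE : K⟮x⟯ = ⊤) {a : E} (ha : ‖φ a‖ ≤ 1) :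
    ∃ g : K[X], IsIntegralPoly Ω g ∧ aeval x g = aeval x (minpoly K x).derivative * a := by
  have hmap : IntermediateField.map φ ⊤ = K⟮φ x⟯ := by
    rw [← hxE, IntermediateField.adjoin_map, Set.image_singleton]
  have haE : φ a ∈ K⟮φ x⟯ := hmap ▸ ⟨a, trivial, rfl⟩
  obtain ⟨g, hg, hgx⟩ := exists_aeval_eq_derivative_minpoly_mul hG hx haE ha
  refine ⟨g, hg, φ.toRingHom.injective ?_⟩
  change φ (aeval x g) = φ (_ * a)
  rw [map_mul, ← aeval_algHom_apply, ← aeval_algHom_apply, hgx,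
    minpoly.algHom_eq φ φ.toRingHom.injective]

end FiniteExtension

section SpectralNorm

universe u v

theorem exists_integral_generator {F : Type u} [NontriviallyNormedField F] [IsUltrametricDist F]
    [CompleteSpace F] [CharZero F] {E : Type v} [Field E] [Algebra F E] [FiniteDimensional F E]
    (ν : AbsoluteValue E ℝ) (hν : ∀ a : F, ν (algebraMap F E a) = ‖a‖) {p : ℕ} (hp : p.Prime)
    (hp1 : ‖(p : F)‖ < 1) (hd : ∀ r < (1 : ℝ), ∃ a : F, r < ‖a‖ ∧ ‖a‖ < 1)
    (hF : ∀ a : F, ‖a‖ ≤ 1 → ∃ b : F, ‖a - b ^ p‖ ≤ ‖(p : F)‖) :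
    (∀ a : E, ν a ≤ 1 → ∃ b : E, ν (a - b ^ p) ≤ ‖(p : F)‖) ∧
    ∃ x : E, ν x ≤ 1 ∧ (∀ i, ‖(minpoly F x).coeff i‖ ≤ 1) ∧
      ∀ a : E, ν a ≤ 1 → ∃ g : F[X], (∀ i, ‖g.coeff i‖ ≤ 1) ∧
        aeval x g = aeval x (minpoly F x).derivative * a := by
  let Ω := AlgebraicClosure F
  let _ : NormedField Ω := spectralNorm.normedField F Ω
  have hΩ : IsUltrametricDist Ω :=
    IsUltrametricDist.isUltrametricDist_of_isNonarchimedean_norm isNonarchimedean_spectralNorm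
  have hext : ∀ a : F, ‖algebraMap F Ω a‖ = ‖a‖ := spectralNorm_extends
  have hG : IsGaloisInvariantNorm Ω F := fun σ x => (spectralNorm_eq_of_equiv σ x).symm
  let φ : E →ₐ[F] Ω := IsAlgClosed.lift
  have hφ : ∀ a, ‖φ a‖ = ν a := fun a => by
    rw [spectralNorm_unique_field_norm_ext hν a, spectralNorm,
      ← minpoly.algHom_eq φ φ.toRingHom.injective]
    rfl
  have hpΩ : ‖(p : Ω)‖ = ‖(p : F)‖ := by rw [← hext, map_natCast]
  have hpF : (p : F) ≠ 0 := Nat.cast_ne_zero.mpr hp.ne_zero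
  have hp0 : 0 < ‖(p : Ω)‖ := hpΩ ▸ norm_pos_iff.mpr hpF
  have hd' : HasNormsNearOne Ω F := by simpa only [HasNormsNearOne, hext] using hd
  have hF' : IsFrobeniusSurjective Ω F p := by
    simpa only [IsFrobeniusSurjective, hext, hpΩ] using hF
  obtain ⟨x, hx, hxE⟩ := exists_primitive_element_norm_le_one φ hpF (by rwa [hext])
  refine ⟨fun a ha => ?_, x, hφ x ▸ hx, fun i => ?_, fun a ha => ?_⟩
  · obtain ⟨b, hb⟩ := hF'.exists_norm_algHom_sub_pow_le hp hp0 (hpΩ ▸ hp1) hG hd' φ hx hxE a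
      ((hφ a).trans_le ha)
    exact ⟨b, by rwa [hφ, hpΩ] at hb⟩
  · rw [← hext, ← minpoly.algHom_eq φ φ.toRingHom.injective]
    exact hG.isIntegralPoly_minpoly hx i
  · obtain ⟨g, hg, h⟩ := exists_aeval_eq_derivative_minpoly_mul_of_algHom hG φ hx hxE
      ((hφ a).trans_le ha)
    exact ⟨g, fun i => (hext _).symm.trans_le (hg i), h⟩

end SpectralNorm

section Differentials

open KaehlerDifferential in
theorem kaehlerDifferential_eq_smul_of_pow_surjective {R S : Type*} [CommRing R] [CommRing S]
    [Algebra R S] (p : ℕ) (h : ∀ a : S, ∃ b e : S, a = b ^ p + p * e) (n : ℕ) (ω : Ω[S⁄R]) :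
    ∃ η : Ω[S⁄R], ω = (p : S) ^ n • η := by
  have key : ∀ ω : Ω[S⁄R], ∃ η : Ω[S⁄R], ω = (p : S) • η := by
    intro ω
    have hω : ω ∈ Submodule.span S (Set.range (D R S)) := by
      rw [span_range_derivation]
      trivial
    induction hω using Submodule.span_induction with
    | mem ω hω =>
      obtain ⟨a, rfl⟩ := hω
      obtain ⟨b, e, rfl⟩ := h a
      refine ⟨b ^ (p - 1) • D R S b + D R S e, ?_⟩
      rw [map_add, Derivation.leibniz_pow, Derivation.leibniz, Derivation.map_natCast, smul_zero,
        add_zero, smul_add, ← Nat.cast_smul_eq_nsmul S]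
    | zero => exact ⟨0, (smul_zero _).symm⟩
    | add ω₁ ω₂ _ _ h₁ h₂ =>
      obtain ⟨η₁, rfl⟩ := h₁
      obtain ⟨η₂, rfl⟩ := h₂
      exact ⟨η₁ + η₂, (smul_add _ _ _).symm⟩
    | smul c ω _ h =>
      obtain ⟨η, rfl⟩ := h
      exact ⟨c • η, smul_comm _ _ _⟩
  induction n generalizing ω with
  | zero => exact ⟨ω, by simp⟩
  | succ n ih =>
    obtain ⟨η, rfl⟩ := ih ω
    obtain ⟨η', rfl⟩ := key η
    exact ⟨η', by rw [smul_smul, pow_succ]⟩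

open KaehlerDifferential in
theorem derivative_sq_smul_kaehlerDifferential_eq_zero {R S : Type*} [CommRing R] [CommRing S]
    [Algebra R S] {x : S} {f : R[X]} (hf : aeval x f = 0)
    (h : ∀ a : S, ∃ g : R[X], aeval x g = aeval x f.derivative * a) (ω : Ω[S⁄R]) :
    aeval x f.derivative ^ 2 • ω = 0 := by
  have hD : ∀ q : R[X], D R S (aeval x q) = aeval x q.derivative • D R S x := fun q =>
    (D R S).map_aeval q x
  have hx : aeval x f.derivative • D R S x = 0 := by rw [← hD, hf, map_zero]
  have hω : ω ∈ Submodule.span S (Set.range (D R S)) := by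
    rw [span_range_derivation]
    trivial
  induction hω using Submodule.span_induction with
  | mem ω hω =>
    obtain ⟨a, rfl⟩ := hω
    obtain ⟨g, hg⟩ := h a
    have hDg := congrArg (aeval x f.derivative • D R S ·) hg
    simp only [hD, Derivation.leibniz, smul_add] at hDg
    rw [smul_comm, hx, smul_zero, smul_comm (aeval x f.derivative) a,
      smul_comm (aeval x f.derivative) (aeval x f.derivative.derivative), hx, smul_zero, smul_zero,
      add_zero, smul_smul, ← sq] at hDg
    exact hDg.symm
  | zero => exact smul_zero _
  | add ω₁ ω₂ _ _ h₁ h₂ => rw [smul_add, h₁, h₂, add_zero]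
  | smul c ω _ h => rw [smul_comm, h, smul_zero]

end Differentials

namespace CompleteMulNorm

variable {F : Type*} [Field F] (ν : CompleteMulNorm F)

/-- A complete multiplicative norm, viewed as an absolute value. -/
def toAbsoluteValue : AbsoluteValue F ℝ where
  toFun := ν.nrm
  map_mul' := ν.mul
  nonneg' := ν.nonneg
  eq_zero' := ν.eq_zero_iff
  add_le' x y := (ν.nonarch x y).trans (max_le_add_of_nonneg (ν.nonneg x) (ν.nonneg y))

theorem IsPerfectoid.exists_nrm_mem_Ioo {ν : CompleteMulNorm F} {p : ℕ} (h : ν.IsPerfectoid p)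
    {r : ℝ} (hr : r < 1) : ∃ a : F, r < ν.nrm a ∧ ν.nrm a < 1 := by
  obtain ⟨s, hs, hs1⟩ := exists_between (max_lt hr one_pos)
  rw [max_lt_iff] at hs
  obtain ⟨a, -, h1, h2⟩ := h.2.2.1 (s⁻¹ - 1) (sub_pos.mpr ((one_lt_inv₀ hs.2).mpr hs1))
  have hinv : ν.nrm a⁻¹ = (ν.nrm a)⁻¹ := map_inv₀ ν.toAbsoluteValue a
  rw [add_sub_cancel] at h2
  refine ⟨a⁻¹, ?_, ?_⟩ <;> rw [hinv]
  · exact hs.1.trans ((lt_inv_comm₀ (one_pos.trans h1) hs.2).mp h2)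
  · exact inv_lt_one_of_one_lt₀ h1

universe u v

theorem IsPerfectoid.exists_integral_generator {F : Type u} {E : Type v} [Field F] [Field E]
    [Algebra F E] [FiniteDimensional F E] {νF : CompleteMulNorm F} {νE : CompleteMulNorm E}
    (hisom : ∀ x : F, νE.nrm (algebraMap F E x) = νF.nrm x) {p : ℕ} (hp : p.Prime)
    (hF : νF.IsPerfectoid p) :
    (∀ a : E, νE.nrm a ≤ 1 → ∃ b : E, νE.nrm (a - b ^ p) ≤ νF.nrm p) ∧
    ∃ x : E, νE.nrm x ≤ 1 ∧ (∀ i, νF.nrm ((minpoly F x).coeff i) ≤ 1) ∧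
      ∀ a : E, νE.nrm a ≤ 1 → ∃ g : F[X], (∀ i, νF.nrm (g.coeff i) ≤ 1) ∧
        aeval x g = aeval x (minpoly F x).derivative * a := by
  have := hF.1
  obtain ⟨y, -, hy, -⟩ := hF.2.2.1 1 one_pos
  let _ : NontriviallyNormedField F :=
    { νF.toAbsoluteValue.toNormedField with non_trivial := ⟨y, hy⟩ }
  have : IsUltrametricDist F :=
    IsUltrametricDist.isUltrametricDist_of_isNonarchimedean_norm νF.nonarch
  have hdist : ∀ a b : F, dist a b = νF.nrm (a - b) := dist_eq_norm
  have : CompleteSpace F := Metric.complete_of_cauchySeq_tendsto fun u hu => by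
    rw [Metric.cauchySeq_iff] at hu
    simp only [Metric.tendsto_atTop, hdist] at hu ⊢
    exact νF.complete u hu
  exact _root_.exists_integral_generator νE.toAbsoluteValue hisom hp hF.2.1
    (fun r hr => hF.exists_nrm_mem_Ioo hr) hF.2.2.2

end CompleteMulNorm

theorem Polynomial.exists_map_subtype_eq {F : Type*} [CommRing F] (R : Subring F) {g : F[X]}
    (hg : ∀ i, g.coeff i ∈ R) : ∃ q : R[X], q.map R.subtype = g :=
  (mem_lifts g).mp ((lifts_iff_coeff_lifts g).mpr fun i => ⟨⟨g.coeff i, hg i⟩, rfl⟩)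

/-- Perfectoid fields are deeply ramified: for a finite extension `E`
of a perfectoid field `F` (with isometric structure map), the module of Kähler
differentials `Ω_{𝔬_E/𝔬_F}` vanishes. -/
theorem kaehlerDifferential_subsingleton_of_perfectoid
    (p : ℕ) (hp : p.Prime) (F E : Type*) [Field F] [Field E]
    [Algebra F E] [FiniteDimensional F E]
    (νF : CompleteMulNorm F) (νE : CompleteMulNorm E)
    (hisom : ∀ x : F, νE.nrm (algebraMap F E x) = νF.nrm x)
    (hF : νF.IsPerfectoid p)
    [Algebra νF.intRing νE.intRing]
    (hcompat : ∀ x : νF.intRing,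
      (algebraMap νF.intRing νE.intRing x : E) = algebraMap F E (x : F)) :
    Subsingleton (Ω[νE.intRing⁄νF.intRing]) := by
  have := hF.1
  have : CharZero E := charZero_of_injective_algebraMap (algebraMap F E).injective
  have hpE : (p : E) ≠ 0 := Nat.cast_ne_zero.mpr hp.ne_zero
  have hpEF : νE.nrm p = νF.nrm p := by rw [← hisom, map_natCast]
  have hdiv : ∀ {a b : E}, b ≠ 0 → νE.nrm a ≤ νE.nrm b → νE.nrm (a / b) ≤ 1 := fun hb hab =>
    (map_div₀ νE.toAbsoluteValue _ _).trans_le (div_le_one_of_le₀ hab (νE.nonneg _))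
  obtain ⟨hfrob, x, hx, hf, hg⟩ := hF.exists_integral_generator hisom hp
  let x' : νE.intRing := ⟨x, hx⟩
  have hcoe : ∀ q : νF.intRing[X], (aeval x' q : E) = aeval x (q.map νF.intRing.subtype) :=
    fun q => by
      rw [aeval_def, aeval_def, eval₂_map, ← Subring.coe_subtype, hom_eval₂]
      exact congrArg (eval₂ · x q) (RingHom.ext hcompat)
  obtain ⟨f, hf⟩ := exists_map_subtype_eq νF.intRing hf
  have hf0 : aeval x' f = 0 := Subtype.ext (by rw [hcoe, hf, minpoly.aeval]; rfl)
  have hf' : (aeval x' f.derivative : E) = aeval x (minpoly F x).derivative := by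
    rw [hcoe, ← derivative_map, hf]
  have hann := derivative_sq_smul_kaehlerDifferential_eq_zero hf0 fun a => by
    obtain ⟨g, hg, hga⟩ := hg a a.2
    obtain ⟨g, rfl⟩ := exists_map_subtype_eq νF.intRing hg
    exact ⟨g, Subtype.ext (by rw [hcoe, hga, ← hf']; rfl)⟩
  have hpow : ∀ a : νE.intRing, ∃ b e : νE.intRing, a = b ^ p + p * e := by
    intro a
    obtain ⟨b, hb⟩ := hfrob a a.2
    rw [← hpEF] at hb
    have hbp : νE.nrm (b ^ p) ≤ 1 := by
      have h := νE.intRing.sub_mem a.2 (hb.trans (hpEF.trans_le hF.2.1.le))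
      rwa [sub_sub_cancel] at h
    have hb1 : νE.nrm b ≤ 1 := (pow_le_one_iff_of_nonneg (νE.nonneg b) hp.ne_zero).mp
      ((map_pow νE.toAbsoluteValue b p).symm.trans_le hbp)
    refine ⟨⟨b, hb1⟩, ⟨(a - b ^ p) / p, hdiv hpE hb⟩, Subtype.ext ?_⟩
    change (a : E) = b ^ p + ((p : νE.intRing) : E) * ((a - b ^ p) / p)
    rw [Subring.coe_natCast, mul_div_cancel₀ _ hpE, add_sub_cancel]
  have hne : (aeval x' f.derivative : E) ^ 2 ≠ 0 := by
    rw [hf']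
    exact pow_ne_zero 2
      ((Algebra.IsSeparable.isSeparable F x).aeval_derivative_ne_zero (minpoly.aeval F x))
  obtain ⟨n, hn⟩ := exists_pow_lt_of_lt_one (νE.toAbsoluteValue.pos hne) hF.2.1
  have hdvd : νE.nrm ((p : E) ^ n) ≤ νE.nrm ((aeval x' f.derivative : E) ^ 2) := by
    have h : νE.nrm ((p : E) ^ n) = νE.nrm p ^ n := map_pow νE.toAbsoluteValue _ _
    rw [h, hpEF]
    exact hn.le
  have hq : (p : νE.intRing) ^ n =
      ⟨(p : E) ^ n / (aeval x' f.derivative : E) ^ 2, hdiv hne hdvd⟩ * aeval x' f.derivative ^ 2 :=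
    Subtype.ext (by
      change ((p : νE.intRing) : E) ^ n = _ / _ * _
      rw [Subring.coe_natCast]
      exact (div_mul_cancel₀ _ hne).symm)
  refine subsingleton_of_forall_eq 0 fun ω => ?_
  obtain ⟨η, rfl⟩ := kaehlerDifferential_eq_smul_of_pow_surjective p hpow n ω
  rw [hq, mul_smul, hann, smul_zero]
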